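/- For every p ∈ (3/2, ∞] there exists a constant C_p > 0 such that for every dimension d ∈ ℕ and every f ∈ ℓ^p(ℤ^d) one has ‖ sup_{t>0} |𝓜_t f| ‖_{ℓ^p(ℤ^d)} ≤ C_p ‖f‖_{ℓ^p(ℤ^d)}; the constant C_p is independent of the dimension d. -/

import Mathlib

open MeasureTheory ENNReal

/-- The ℓ^p(ℤ^d) "norm" of a nonnegative (ℝ≥0∞-valued) function, `p ∈ (0,∞]`. -/
noncomputable def lpZ (d : ℕ) (p : ℝ≥0∞) (g : (Fin d → ℤ) → ℝ≥0∞) : ℝ≥0∞ :=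
  if p = ∞ then ⨆ x, g x else (∑' x, g x ^ p.toReal) ^ (1 / p.toReal)

/-- `x ↦ ‖f x‖₊` as an ℝ≥0∞-valued function. -/
noncomputable def nnC {d : ℕ} (f : (Fin d → ℤ) → ℂ) : (Fin d → ℤ) → ℝ≥0∞ :=
  fun x => (‖f x‖₊ : ℝ≥0∞)

/-- The discrete Hardy–Littlewood averaging operator over the cube `Q_t = [-t,t]^d`:
`𝓜_t f(x) = (2⌊t⌋+1)^{-d} Σ_{|y|_∞ ≤ ⌊t⌋} f(x-y)`. -/
noncomputable def cubeAvg (d : ℕ) (t : ℝ) (f : (Fin d → ℤ) → ℂ) (x : Fin d → ℤ) : ℂ :=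
  (((2 * ⌊t⌋ + 1) ^ d : ℤ) : ℂ)⁻¹ *
    ∑ y ∈ Finset.Icc (fun _ => -⌊t⌋ : Fin d → ℤ) (fun _ => ⌊t⌋), f (x - y)


section trig

lemma sin_key (L : ℕ) (hL : 2 ≤ L) (θ : ℝ) :
    Real.sin (L * θ) ^ 2 * (1 + (L:ℝ) ^ 2 * Real.sin θ ^ 2 / 4) ≤ (L:ℝ) ^ 2 * Real.sin θ ^ 2 := by
  have hL' : (2:ℝ) ≤ L := by exact_mod_cast hL
  -- base case
  have base : ∀ t : ℝ, 0 ≤ t → t ≤ Real.pi / 2 →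
      Real.sin (L * t) ^ 2 * (1 + (L:ℝ) ^ 2 * Real.sin t ^ 2 / 4) ≤ (L:ℝ) ^ 2 * Real.sin t ^ 2 := by
    intro t ht0 ht1
    rcases le_or_gt Real.pi (L * t) with h | h
    · have h1 := Real.mul_le_sin ht0 ht1
      have h2 : 2 ≤ L * Real.sin t := by
        have : L * (2 / Real.pi * t) ≤ L * Real.sin t := by gcongr
        refine le_trans ?_ this
        have hp := Real.pi_pos
        have e : L * (2 / Real.pi * t) = 2 * (L * t) / Real.pi := by field_simp
        rw [e, le_div_iff₀ hp]; linarith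
      have h3 : 4 ≤ (L:ℝ) ^ 2 * Real.sin t ^ 2 := by rw [← mul_pow]; nlinarith
      have h4 := Real.sin_sq_le_one (L * t)
      nlinarith [mul_le_mul_of_nonneg_right h4 (show (0:ℝ) ≤ 1 + (L:ℝ) ^ 2 * Real.sin t ^ 2 / 4 by positivity)]
    · have hs0 : 0 ≤ Real.sin (L * t / 2) := by
        apply Real.sin_nonneg_of_nonneg_of_le_pi
        · positivity
        · have := mul_nonneg (by linarith : (0:ℝ) ≤ L) ht0; linarith
      have hc : 2 * Real.sin (L * t / 2) ≤ L * Real.sin t := by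
        have hLp : (0:ℝ) < L := by linarith
        have hcc := (strictConcaveOn_sin_Icc.concaveOn).2
        have := @hcc (L * t / 2)
          ⟨by positivity, by have := mul_nonneg (by linarith : (0:ℝ) ≤ L) ht0; linarith⟩
          0 ⟨le_rfl, Real.pi_pos.le⟩ (2 / L) (1 - 2 / L) (by positivity)
          (by rw [sub_nonneg, div_le_one hLp]; exact hL') (by ring)
        simp only [smul_eq_mul, mul_zero, add_zero, Real.sin_zero] at this
        have e : 2 / (L:ℝ) * (L * t / 2) = t := by field_simp
        rw [e] at this
        have := mul_le_mul_of_nonneg_left this hLp.le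
        have e2 : (L:ℝ) * (2 / L * Real.sin (L * t / 2)) = 2 * Real.sin (L * t / 2) := by field_simp
        linarith
      have e : Real.sin (L * t) = 2 * Real.sin (L * t / 2) * Real.cos (L * t / 2) := by
        rw [← Real.sin_two_mul]; congr 1; ring
      rw [e, ← mul_pow]
      set Y := L * Real.sin t
      set s := Real.sin (L * t / 2)
      set c := Real.cos (L * t / 2)
      have hsc : s ^ 2 + c ^ 2 = 1 := Real.sin_sq_add_cos_sq _
      have hY : 4 * s ^ 2 ≤ Y ^ 2 := by nlinarith
      have hc2 : c ^ 2 ≤ 1 := by nlinarith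
      have h5 : 0 ≤ 1 - s ^ 2 * c ^ 2 := by nlinarith [sq_nonneg s, sq_nonneg c]
      nlinarith [mul_le_mul_of_nonneg_right hY h5, mul_nonneg (mul_nonneg (sq_nonneg s) (sq_nonneg s)) (sub_nonneg.2 hc2)]
  -- reduction
  obtain ⟨k, hk⟩ : ∃ k : ℤ, |θ - k * Real.pi| ≤ Real.pi / 2 := by
    refine ⟨round (θ / Real.pi), ?_⟩
    have h := abs_sub_round (θ / Real.pi)
    have hp := Real.pi_pos
    have e : θ - round (θ / Real.pi) * Real.pi = (θ / Real.pi - round (θ / Real.pi)) * Real.pi := by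
      field_simp
    rw [e, abs_mul, abs_of_pos hp]; nlinarith
  have := base _ (abs_nonneg _) hk
  have per : ∀ (x : ℝ) (m : ℤ), Real.sin (x - m * Real.pi) ^ 2 = Real.sin x ^ 2 := by
    intro x m
    rw [Real.sin_sub_int_mul_pi, mul_pow]
    rcases Int.even_or_odd m with h | h
    · rw [h.neg_one_zpow]; simp
    · rw [h.neg_one_zpow]; simp
  have e1 : Real.sin |θ - k * Real.pi| ^ 2 = Real.sin θ ^ 2 := by
    rw [← per θ k]
    rcases abs_choice (θ - k * Real.pi) with h | h <;> rw [h]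
    rw [Real.sin_neg, neg_sq]
  have e2 : Real.sin (L * |θ - k * Real.pi|) ^ 2 = Real.sin (L * θ) ^ 2 := by
    rw [← per (L * θ) (L * k)]
    have e : (L:ℝ) * θ - ((L * k : ℤ) : ℝ) * Real.pi = L * (θ - k * Real.pi) := by push_cast; ring
    rw [e]
    rcases abs_choice (θ - k * Real.pi) with h | h <;> rw [h]
    rw [mul_neg, Real.sin_neg, neg_sq]
  rwa [e1, e2] at this

lemma sin_nat_sq (n : ℕ) (θ : ℝ) : Real.sin (n * θ) ^ 2 ≤ (n:ℝ) ^ 2 * Real.sin θ ^ 2 := by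
  rcases Nat.lt_or_ge n 2 with h | h
  · interval_cases n <;> simp
  · have := sin_key n h θ
    have h2 : 0 ≤ Real.sin (n * θ) ^ 2 * ((n:ℝ) ^ 2 * Real.sin θ ^ 2 / 4) := by positivity
    linarith

noncomputable def Dk (N : ℕ) (θ : ℝ) : ℝ :=
  (1 + 2 * ∑ k ∈ Finset.range N, Real.cos (2 * (k + 1) * θ)) / (2 * N + 1)

lemma Dk_sin (N : ℕ) (θ : ℝ) :
    Real.sin θ * ((2 * N + 1) * Dk N θ) = Real.sin ((2 * N + 1) * θ) := by
  have h0 : (2 * (N:ℝ) + 1) ≠ 0 := by positivity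
  unfold Dk
  rw [mul_div_cancel₀ _ h0]
  clear h0
  induction N with
  | zero => simp
  | succ N ih =>
    rw [Finset.sum_range_succ]
    have e1 : Real.sin ((2 * ((N + 1 : ℕ):ℝ) + 1) * θ) =
        Real.sin (2 * (N + 1) * θ + θ) := by congr 1; push_cast; ring
    have e2 : Real.sin ((2 * (N:ℝ) + 1) * θ) = Real.sin (2 * (N + 1) * θ - θ) := by
      congr 1; ring
    rw [e1, Real.sin_add]
    rw [e2, Real.sin_sub] at ih
    linarith

lemma Dk_abs (N : ℕ) (θ : ℝ) : |Dk N θ| ≤ 1 := by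
  have h0 : (0:ℝ) < 2 * N + 1 := by positivity
  unfold Dk
  rw [abs_div, abs_of_pos h0, div_le_one h0]
  have h : |∑ k ∈ Finset.range N, Real.cos (2 * (k + 1) * θ)| ≤ N := by
    refine (Finset.abs_sum_le_sum_abs _ _).trans ?_
    refine (Finset.sum_le_sum fun k _ => Real.abs_cos_le_one _).trans ?_
    simp
  rw [abs_le] at *
  constructor <;> linarith [h.1, h.2]

lemma Dk_sq (N : ℕ) (θ : ℝ) : Dk N θ ^ 2 * (1 + (N:ℝ) ^ 2 * Real.sin θ ^ 2) ≤ 1 := by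
  have habs : Dk N θ ^ 2 ≤ 1 := by rw [← sq_abs]; exact pow_le_one₀ (abs_nonneg _) (Dk_abs N θ)
  rcases Nat.eq_zero_or_pos N with rfl | hN
  · simpa using habs
  by_cases hy : Real.sin θ = 0
  · rw [hy]; simpa using habs
  have hk := sin_key (2 * N + 1) (by omega) θ
  push_cast at hk
  rw [← Dk_sin] at hk
  have hy2 : 0 < Real.sin θ ^ 2 := by positivity
  have hL : (0:ℝ) < (2 * N + 1) ^ 2 := by positivity
  have h1 : Dk N θ ^ 2 * (1 + (2 * (N:ℝ) + 1) ^ 2 * Real.sin θ ^ 2 / 4) ≤ 1 := by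
    refine le_of_mul_le_mul_left ?_ (mul_pos hL hy2)
    calc _ = _ := ?_
      _ ≤ _ := hk
      _ = _ := by ring
    ring
  refine le_trans (mul_le_mul_of_nonneg_left ?_ (sq_nonneg _)) h1
  have : (N:ℝ) ^ 2 ≤ (2 * N + 1) ^ 2 / 4 := by nlinarith [(Nat.cast_nonneg N : (0:ℝ) ≤ N)]
  nlinarith [mul_le_mul_of_nonneg_right this hy2.le]

lemma one_sub_cos2 (n : ℕ) (θ : ℝ) : 1 - Real.cos (2 * n * θ) ≤ 2 * ((n:ℝ) ^ 2 * Real.sin θ ^ 2) := by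
  have h := sin_nat_sq n θ
  have : Real.cos (2 * n * θ) = 1 - 2 * Real.sin (n * θ) ^ 2 := by
    rw [mul_assoc, Real.cos_two_mul, Real.cos_sq']; ring
  rw [this]; linarith

lemma Dk_one_sub (N : ℕ) (θ : ℝ) : 1 - Dk N θ ≤ 2 * ((N:ℝ) ^ 2 * Real.sin θ ^ 2) := by
  have h0 : (0:ℝ) < 2 * N + 1 := by positivity
  have hs : ∑ k ∈ Finset.range N, (1 - Real.cos (2 * (k + 1) * θ)) ≤
      N * (2 * ((N:ℝ) ^ 2 * Real.sin θ ^ 2)) := by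
    have : ∀ k ∈ Finset.range N, (1 - Real.cos (2 * (k + 1) * θ)) ≤ 2 * ((N:ℝ) ^ 2 * Real.sin θ ^ 2) := by
      intro k hk
      have h1 := one_sub_cos2 (k + 1) θ
      push_cast at h1
      refine h1.trans ?_
      have : (k:ℝ) + 1 ≤ N := by exact_mod_cast Finset.mem_range.1 hk
      gcongr
    refine (Finset.sum_le_sum this).trans ?_
    simp
  rw [Finset.sum_sub_distrib] at hs
  simp only [Finset.sum_const, Finset.card_range, nsmul_eq_mul, mul_one] at hs
  have e : 1 - Dk N θ = (2 * (N - ∑ k ∈ Finset.range N, Real.cos (2 * (k + 1) * θ))) / (2 * N + 1) := by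
    unfold Dk
    generalize ∑ k ∈ Finset.range N, Real.cos (2 * ((k:ℝ) + 1) * θ) = S
    field_simp; ring
  rw [e, div_le_iff₀ h0]
  have : 0 ≤ (N:ℝ) ^ 2 * Real.sin θ ^ 2 := by positivity
  nlinarith

lemma Dk_diff (N : ℕ) (hN : 1 ≤ N) (θ : ℝ) :
    |Dk (N + 1) θ - Dk N θ| ≤ 10 / N * min 1 ((N:ℝ) ^ 2 * Real.sin θ ^ 2) := by
  have hN' : (1:ℝ) ≤ N := by exact_mod_cast hN
  have h0 : (0:ℝ) < 2 * N + 3 := by positivity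
  have e : Dk (N + 1) θ - Dk N θ = 2 * (Real.cos (2 * (N + 1) * θ) - Dk N θ) / (2 * N + 3) := by
    unfold Dk; rw [Finset.sum_range_succ]
    generalize ∑ k ∈ Finset.range N, Real.cos (2 * ((k:ℝ) + 1) * θ) = S
    push_cast; field_simp; ring
  rw [e, abs_div, abs_of_pos h0, div_le_iff₀ h0, abs_mul, abs_of_pos (by norm_num : (0:ℝ) < 2)]
  set Y := (N:ℝ) ^ 2 * Real.sin θ ^ 2 with hY
  have hY0 : 0 ≤ Y := by positivity
  have h1 := Dk_one_sub N θ
  have h2 := one_sub_cos2 (N + 1) θ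
  push_cast at h2
  have h3 : ((N:ℝ) + 1) ^ 2 * Real.sin θ ^ 2 ≤ 4 * Y := by
    rw [hY, ← mul_assoc]; gcongr; nlinarith
  have h4 := abs_le.1 (Dk_abs N θ)
  have h5 := Real.cos_le_one (2 * (N + 1) * θ)
  have h6 := Real.neg_one_le_cos (2 * (N + 1) * θ)
  have ha : |Real.cos (2 * (N + 1) * θ) - Dk N θ| ≤ 10 * min 1 Y := by
    rcases min_cases 1 Y with h | h
    · rw [h.1, abs_le]; constructor <;> linarith
    · rw [h.1, abs_le]; constructor <;> linarith
  have hm : 0 ≤ min 1 Y := le_min zero_le_one hY0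
  have e2 : 10 / (N:ℝ) * min 1 Y * (2 * N + 3) = 20 * min 1 Y + 30 / N * min 1 Y := by
    field_simp; ring
  rw [e2]
  have : 0 ≤ 30 / (N:ℝ) * min 1 Y := by positivity
  linarith

noncomputable def gk (n : ℕ) (θ : ℝ) : ℝ := ∏ k ∈ Finset.range n, Real.cos (2 ^ k * θ) ^ 2

lemma gk_nonneg (n : ℕ) (θ : ℝ) : 0 ≤ gk n θ := Finset.prod_nonneg fun _ _ => sq_nonneg _
lemma gk_le_one (n : ℕ) (θ : ℝ) : gk n θ ≤ 1 :=
  Finset.prod_le_one (fun _ _ => sq_nonneg _) fun _ _ => Real.cos_sq_le_one _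
lemma gk_succ_le (n : ℕ) (θ : ℝ) : gk (n + 1) θ ≤ gk n θ := by
  unfold gk
  rw [Finset.prod_range_succ]
  exact mul_le_of_le_one_right (gk_nonneg n θ) (Real.cos_sq_le_one _)

lemma gk_sin (n : ℕ) (θ : ℝ) : 4 ^ n * Real.sin θ ^ 2 * gk n θ = Real.sin (2 ^ n * θ) ^ 2 := by
  induction n with
  | zero => simp [gk]
  | succ n ih =>
    have e : Real.sin (2 ^ (n + 1) * θ) = 2 * Real.sin (2 ^ n * θ) * Real.cos (2 ^ n * θ) := by
      rw [← Real.sin_two_mul]; congr 1; ring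
    rw [e, mul_pow, mul_pow, ← ih]
    unfold gk
    rw [Finset.prod_range_succ]; ring

lemma gk_decay (n : ℕ) (hn : 1 ≤ n) (θ : ℝ) : gk n θ * (1 + 4 ^ n / 4 * Real.sin θ ^ 2) ≤ 1 := by
  by_cases hy : Real.sin θ = 0
  · rw [hy]; simpa using gk_le_one n θ
  have hk := sin_key (2 ^ n) (by calc 2 = 2 ^ 1 := rfl
                                  _ ≤ 2 ^ n := Nat.pow_le_pow_right (by norm_num) hn) θ
  push_cast at hk
  rw [← gk_sin] at hk
  have e4 : ((2:ℝ) ^ n) ^ 2 = 4 ^ n := by rw [← pow_mul, mul_comm, pow_mul]; norm_num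
  rw [e4] at hk
  have hy2 : 0 < Real.sin θ ^ 2 := by positivity
  refine le_of_mul_le_mul_left ?_ (show (0:ℝ) < 4 ^ n * Real.sin θ ^ 2 by positivity)
  calc _ = _ := ?_
    _ ≤ _ := hk
    _ = _ := by ring
  ring

lemma gk_one_sub (n : ℕ) (θ : ℝ) : 1 - gk n θ ≤ 4 ^ n * Real.sin θ ^ 2 := by
  have : 1 - gk n θ ≤ (4 ^ n - 1) / 3 * Real.sin θ ^ 2 := by
    induction n with
    | zero => simp [gk]
    | succ n ih =>
      have e : gk (n + 1) θ = gk n θ * Real.cos (2 ^ n * θ) ^ 2 := by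
        unfold gk; rw [Finset.prod_range_succ]
      rw [e, Real.cos_sq']
      have h := sin_nat_sq (2 ^ n) θ
      push_cast at h
      have e4 : ((2:ℝ) ^ n) ^ 2 = 4 ^ n := by rw [← pow_mul, mul_comm, pow_mul]; norm_num
      rw [e4] at h
      have h2 := mul_le_mul_of_nonneg_right (gk_le_one n θ) (sq_nonneg (Real.sin (2 ^ n * θ)))
      rw [pow_succ (4:ℝ) n]
      linarith
  refine this.trans ?_
  gcongr
  have : (1:ℝ) ≤ 4 ^ n := one_le_pow₀ (by norm_num)
  linarith

section prods
variable {I : Type*} (s : Finset I)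

lemma one_add_sum_le (x : I → ℝ) (hx : ∀ i ∈ s, 0 ≤ x i) : 1 + ∑ i ∈ s, x i ≤ ∏ i ∈ s, (1 + x i) := by
  classical
  induction s using Finset.induction_on with
  | empty => simp
  | insert a s ha ih =>
    rw [Finset.sum_insert ha, Finset.prod_insert ha]
    have h1 := ih fun i hi => hx i (Finset.mem_insert_of_mem hi)
    have h2 := hx a (Finset.mem_insert_self _ _)
    have h3 : 0 ≤ ∑ i ∈ s, x i := Finset.sum_nonneg fun i hi => hx i (Finset.mem_insert_of_mem hi)
    nlinarith

lemma abs_one_sub_prod (a : I → ℝ) (ha : ∀ i ∈ s, |a i| ≤ 1) :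
    |1 - ∏ i ∈ s, a i| ≤ ∑ i ∈ s, |1 - a i| := by
  classical
  induction s using Finset.induction_on with
  | empty => simp
  | insert j s hj ih =>
    rw [Finset.sum_insert hj, Finset.prod_insert hj]
    have h1 := ih fun i hi => ha i (Finset.mem_insert_of_mem hi)
    have h2 := ha j (Finset.mem_insert_self _ _)
    have e : 1 - a j * ∏ i ∈ s, a i = (1 - a j) + a j * (1 - ∏ i ∈ s, a i) := by ring
    rw [e]
    refine (abs_add_le _ _).trans ?_
    rw [abs_mul]
    have := mul_le_mul_of_nonneg_right h2 (abs_nonneg (1 - ∏ i ∈ s, a i))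
    linarith

lemma prod_decay (b x : I → ℝ) (hb : ∀ i ∈ s, 0 ≤ b i) (hx : ∀ i ∈ s, 0 ≤ x i)
    (h : ∀ i ∈ s, b i * (1 + x i) ≤ 1) : (∏ i ∈ s, b i) * (1 + ∑ i ∈ s, x i) ≤ 1 := by
  refine (mul_le_mul_of_nonneg_left (one_add_sum_le s x hx) (Finset.prod_nonneg hb)).trans ?_
  rw [← Finset.prod_mul_distrib]
  exact Finset.prod_le_one (fun i hi => mul_nonneg (hb i hi) (by linarith [hx i hi])) h

lemma prod_diff (u v w : I → ℝ) (B : ℝ) (hB : 0 ≤ B) (hw : ∀ i ∈ s, 0 ≤ w i) (hw1 : ∀ i ∈ s, w i ≤ 1)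
    (hu : ∀ i ∈ s, |u i| ≤ 1 / (1 + w i / 3)) (hv : ∀ i ∈ s, |v i| ≤ 1 / (1 + w i / 3))
    (huv : ∀ i ∈ s, |u i - v i| ≤ B * w i) :
    |∏ i ∈ s, u i - ∏ i ∈ s, v i| ≤ 6 * B := by
  classical
  have key : |∏ i ∈ s, u i - ∏ i ∈ s, v i| ≤
      2 * B * (∑ i ∈ s, w i) * ∏ i ∈ s, (1 / (1 + w i / 3)) := by
    induction s using Finset.induction_on with
    | empty => simp
    | insert j s hj ih =>
      rw [Finset.sum_insert hj, Finset.prod_insert hj, Finset.prod_insert hj, Finset.prod_insert hj]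
      have m : ∀ i ∈ s, i ∈ insert j s := fun i hi => Finset.mem_insert_of_mem hi
      have hj' := Finset.mem_insert_self j s
      have ih := ih (fun i hi => hw i (m i hi)) (fun i hi => hw1 i (m i hi))
        (fun i hi => hu i (m i hi)) (fun i hi => hv i (m i hi)) (fun i hi => huv i (m i hi))
      set P := ∏ i ∈ s, (1 / (1 + w i / 3)) with hP
      have hP0 : 0 ≤ P := Finset.prod_nonneg fun i hi => by
        have := hw i (m i hi); positivity
      have hvP : |∏ i ∈ s, v i| ≤ P := by
        rw [Finset.abs_prod]
        exact Finset.prod_le_prod (fun _ _ => abs_nonneg _) fun i hi => hv i (m i hi)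
      have e : u j * ∏ i ∈ s, u i - v j * ∏ i ∈ s, v i =
          u j * (∏ i ∈ s, u i - ∏ i ∈ s, v i) + (u j - v j) * ∏ i ∈ s, v i := by ring
      rw [e]
      refine (abs_add_le _ _).trans ?_
      rw [abs_mul, abs_mul]
      have wj := hw j hj'
      have wj1 := hw1 j hj'
      have a1 : |u j| * |∏ i ∈ s, u i - ∏ i ∈ s, v i| ≤
          (1 / (1 + w j / 3)) * (2 * B * (∑ i ∈ s, w i) * P) :=
        mul_le_mul (hu j hj') ih (abs_nonneg _) (by positivity)
      have a2 : |u j - v j| * |∏ i ∈ s, v i| ≤ B * w j * P :=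
        mul_le_mul (huv j hj') hvP (abs_nonneg _) (by positivity)
      have a3 : (1:ℝ) ≤ 2 * (1 / (1 + w j / 3)) := by
        rw [mul_one_div, le_div_iff₀ (by positivity)]; linarith
      have a4 : B * w j * P * 1 ≤ B * w j * P * (2 * (1 / (1 + w j / 3))) :=
        mul_le_mul_of_nonneg_left a3 (by positivity)
      nlinarith
  refine key.trans ?_
  have h := prod_decay s (fun i => 1 / (1 + w i / 3)) (fun i => w i / 3)
    (fun i hi => by have := hw i hi; positivity) (fun i hi => by have := hw i hi; positivity)
    (fun i hi => by have := hw i hi; rw [one_div, inv_mul_cancel₀ (by positivity)])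
  rw [← Finset.sum_div] at h
  have hP0 : 0 ≤ ∏ i ∈ s, (1 / (1 + w i / 3)) := Finset.prod_nonneg fun i hi => by
    have := hw i hi; positivity
  have : (∑ i ∈ s, w i) * ∏ i ∈ s, (1 / (1 + w i / 3)) ≤ 3 := by nlinarith
  nlinarith [mul_le_mul_of_nonneg_left this hB]
end prods

variable {d : ℕ} (θ : Fin d → ℝ)
noncomputable def sa (N : ℕ) : ℝ := ∏ i, Dk N (θ i)
noncomputable def sF (n : ℕ) : ℝ := ∏ i, gk n (θ i)
noncomputable def sR : ℝ := ∑ i, Real.sin (θ i) ^ 2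

lemma sR_nonneg : 0 ≤ sR θ := Finset.sum_nonneg fun _ _ => sq_nonneg _
lemma sa_abs (N : ℕ) : |sa θ N| ≤ 1 := by
  unfold sa; rw [Finset.abs_prod]
  exact Finset.prod_le_one (fun _ _ => abs_nonneg _) fun _ _ => Dk_abs _ _
lemma sa_sq (N : ℕ) : sa θ N ^ 2 * (1 + (N:ℝ) ^ 2 * sR θ) ≤ 1 := by
  unfold sa sR
  rw [← Finset.prod_pow, Finset.mul_sum]
  exact prod_decay _ _ _ (fun _ _ => sq_nonneg _) (fun _ _ => by positivity) fun _ _ => Dk_sq _ _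
lemma sa_one_sub (N : ℕ) : |1 - sa θ N| ≤ 2 * ((N:ℝ) ^ 2 * sR θ) := by
  refine (abs_one_sub_prod _ _ fun i _ => Dk_abs N (θ i)).trans ?_
  unfold sR
  rw [Finset.mul_sum, Finset.mul_sum]
  refine Finset.sum_le_sum fun i _ => ?_
  rw [abs_of_nonneg (by linarith [(abs_le.1 (Dk_abs N (θ i))).2])]
  exact Dk_one_sub _ _
lemma sa_step (N : ℕ) (hN : 1 ≤ N) : |sa θ (N + 1) - sa θ N| ≤ 60 / N := by
  have hN' : (1:ℝ) ≤ N := by exact_mod_cast hN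
  have aux : ∀ M : ℕ, N ≤ M → ∀ t, |Dk M t| ≤ 1 / (1 + min 1 ((N:ℝ) ^ 2 * Real.sin t ^ 2) / 3) := by
    intro M hM t
    have hM' : (N:ℝ) ≤ M := by exact_mod_cast hM
    have h1 := Dk_sq M t
    set w := min 1 ((N:ℝ) ^ 2 * Real.sin t ^ 2) with hw
    have hw0 : 0 ≤ w := le_min zero_le_one (by positivity)
    have hw1 : w ≤ 1 := min_le_left _ _
    have hw2 : w ≤ (M:ℝ) ^ 2 * Real.sin t ^ 2 := (min_le_right _ _).trans (by gcongr)
    rw [le_div_iff₀ (by positivity)]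
    refine (pow_le_pow_iff_left₀ (by positivity) (by norm_num) two_ne_zero).1 ?_
    rw [mul_pow, sq_abs, one_pow]
    refine le_trans (mul_le_mul_of_nonneg_left ?_ (sq_nonneg _)) h1
    nlinarith
  have := prod_diff Finset.univ (fun i => Dk (N + 1) (θ i)) (fun i => Dk N (θ i))
    (fun i => min 1 ((N:ℝ) ^ 2 * Real.sin (θ i) ^ 2)) (10 / N) (by positivity)
    (fun i _ => le_min zero_le_one (by positivity)) (fun i _ => min_le_left _ _)
    (fun i _ => aux (N + 1) (by omega) _) (fun i _ => aux N le_rfl _) (fun i _ => Dk_diff N hN _)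
  refine this.trans (le_of_eq (by ring))
lemma sa_smooth (N M : ℕ) (hN : 1 ≤ N) : |sa θ (N + M) - sa θ N| ≤ 60 * M / N := by
  have hN' : (1:ℝ) ≤ N := by exact_mod_cast hN
  induction M with
  | zero => simp
  | succ M ih =>
    have h := sa_step θ (N + M) (by omega)
    have e : sa θ (N + (M + 1)) - sa θ N = (sa θ (N + M + 1) - sa θ (N + M)) + (sa θ (N + M) - sa θ N) := by
      rw [← add_assoc]; ring
    rw [e]
    refine (abs_add_le _ _).trans ((add_le_add h ih).trans ?_)
    have : (60:ℝ) / ((N + M : ℕ) : ℝ) ≤ 60 / N := by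
      apply div_le_div_of_nonneg_left (by norm_num) (by positivity); push_cast; linarith [(Nat.cast_nonneg M : (0:ℝ) ≤ M)]
    refine (add_le_add this le_rfl).trans (le_of_eq ?_)
    push_cast; ring

lemma sF_nonneg (n : ℕ) : 0 ≤ sF θ n := Finset.prod_nonneg fun _ _ => gk_nonneg _ _
lemma sF_le_one (n : ℕ) : sF θ n ≤ 1 := Finset.prod_le_one (fun _ _ => gk_nonneg _ _) fun _ _ => gk_le_one _ _
lemma sF_zero : sF θ 0 = 1 := by simp [sF, gk]
lemma sF_succ_le (n : ℕ) : sF θ (n + 1) ≤ sF θ n :=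
  Finset.prod_le_prod (fun _ _ => gk_nonneg _ _) fun _ _ => gk_succ_le _ _
lemma sF_decay (n : ℕ) (hn : 1 ≤ n) : sF θ n * (1 + 4 ^ n / 4 * sR θ) ≤ 1 := by
  unfold sF sR
  rw [Finset.mul_sum]
  exact prod_decay _ _ _ (fun _ _ => gk_nonneg _ _) (fun _ _ => by positivity) fun _ _ => gk_decay _ hn _
lemma sF_one_sub (n : ℕ) : 1 - sF θ n ≤ 4 ^ n * sR θ := by
  refine (le_abs_self _).trans ((abs_one_sub_prod _ _ fun i _ => ?_).trans ?_)
  · rw [abs_of_nonneg (gk_nonneg _ _)]; exact gk_le_one _ _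
  · unfold sR
    rw [Finset.mul_sum]
    refine Finset.sum_le_sum fun i _ => ?_
    rw [abs_of_nonneg (by linarith [gk_le_one n (θ i)])]
    exact gk_one_sub _ _
end trig


lemma geoA (q : ℝ) (hq : 0 < q) (S : Finset ℤ) (y : ℝ) (hy : 0 < y) :
    ∑ k ∈ S, (if (2:ℝ) ^ k ≤ y then ((2:ℝ) ^ k) ^ q else 0) ≤ y ^ q / (1 - 2 ^ (-q)) := by
  obtain ⟨k1, hk1, hk2⟩ := exists_mem_Ico_zpow hy (by norm_num : (1:ℝ) < 2)
  set β : ℝ := 2 ^ (-q) with hβ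
  have hβ0 : 0 < β := Real.rpow_pos_of_pos (by norm_num) _
  have hβ1 : β < 1 := Real.rpow_lt_one_of_one_lt_of_neg (by norm_num) (by linarith)
  rw [← Finset.sum_filter]
  have hle : ∀ k ∈ S.filter (fun k : ℤ => (2:ℝ) ^ k ≤ y), k ≤ k1 := by
    intro k hk
    have h := (Finset.mem_filter.1 hk).2
    have : (2:ℝ) ^ k < 2 ^ (k1 + 1) := lt_of_le_of_lt h hk2
    have := (zpow_lt_zpow_iff_right₀ (by norm_num : (1:ℝ) < 2)).1 this
    omega
  have hterm : ∀ k ∈ S.filter (fun k : ℤ => (2:ℝ) ^ k ≤ y), ((2:ℝ) ^ k) ^ q =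
      ((2:ℝ) ^ k1) ^ q * β ^ ((k1 - k).toNat) := by
    intro k hk
    have h1 := hle k hk
    rw [← Real.rpow_natCast, hβ, ← Real.rpow_intCast, ← Real.rpow_intCast,
      ← Real.rpow_mul (by norm_num), ← Real.rpow_mul (by norm_num), ← Real.rpow_mul (by norm_num),
      ← Real.rpow_add (by norm_num)]
    congr 1
    have : (((k1 - k).toNat : ℕ) : ℝ) = (k1 : ℝ) - k := by
      have : (((k1 - k).toNat : ℕ) : ℤ) = k1 - k := Int.toNat_of_nonneg (by omega)
      exact_mod_cast this
    rw [this]; ring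
  rw [Finset.sum_congr rfl hterm, ← Finset.mul_sum]
  have hinj : Set.InjOn (fun k : ℤ => (k1 - k).toNat)
      (S.filter (fun k : ℤ => (2:ℝ) ^ k ≤ y)) := by
    intro a ha b hb hab
    have h1 := hle a ha
    have h2 := hle b hb
    simp only at hab
    omega
  rw [← Finset.sum_image (f := fun j : ℕ => β ^ j) (g := fun k : ℤ => (k1 - k).toNat) hinj]
  have hs := (summable_geometric_of_lt_one hβ0.le hβ1).sum_le_tsum
    ((S.filter (fun k : ℤ => (2:ℝ) ^ k ≤ y)).image (fun k : ℤ => (k1 - k).toNat))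
    (fun i _ => by positivity)
  rw [tsum_geometric_of_lt_one hβ0.le hβ1] at hs
  rw [div_eq_mul_inv]
  have : ((2:ℝ) ^ k1) ^ q ≤ y ^ q := Real.rpow_le_rpow (by positivity) hk1 hq.le
  have h3 : 0 ≤ (1 - β)⁻¹ := by
    rw [inv_nonneg]; linarith
  gcongr

lemma geoB (q : ℝ) (hq : 0 < q) (S : Finset ℤ) (y : ℝ) (hy : 0 < y) :
    ∑ k ∈ S, (if y ≤ (2:ℝ) ^ k then ((2:ℝ) ^ k) ^ (-q) else 0) ≤ y ^ (-q) / (1 - 2 ^ (-q)) := by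
  have h := geoA q hq (S.image (fun k => -k)) y⁻¹ (by positivity)
  rw [Finset.sum_image (fun a _ b _ h => by simpa using h)] at h
  rw [Real.rpow_neg hy.le, ← Real.inv_rpow hy.le]
  refine le_trans (le_of_eq (Finset.sum_congr rfl fun k _ => ?_)) h
  have h2 : (0:ℝ) < 2 ^ k := by positivity
  simp only [zpow_neg, inv_le_inv₀ h2 hy, Real.rpow_neg h2.le, Real.inv_rpow h2.le]

noncomputable def marcC (r p : ℝ) : ℝ :=
  2 ^ p * (2 ^ r / (1 - 2 ^ (-(p - r))) + 2 ^ (2:ℝ) / (1 - 2 ^ (-(2 - p))))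

lemma marcC_pos (r p : ℝ) (hrp : r < p) (hp2 : p < 2) : 0 < marcC r p := by
  have h1 : (2:ℝ) ^ (-(p - r)) < 1 := Real.rpow_lt_one_of_one_lt_of_neg (by norm_num) (by linarith)
  have h2 : (2:ℝ) ^ (-(2 - p)) < 1 := Real.rpow_lt_one_of_one_lt_of_neg (by norm_num) (by linarith)
  have h1' : 0 < 1 - (2:ℝ) ^ (-(p - r)) := by linarith
  have h2' : 0 < 1 - (2:ℝ) ^ (-(2 - p)) := by linarith
  unfold marcC
  positivity

lemma marc {X : Type*} [Fintype X] (r p : ℝ) (hr : 0 < r) (hrp : r < p) (hp2 : p < 2)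
    (Q : (X → ℝ) → X → ℝ) (hQ0 : ∀ f x, 0 ≤ Q f x)
    (hQ : ∀ f g : X → ℝ, ∀ x, Q (f + g) x ≤ Q f x + Q g x)
    (a b : ℝ) (ha : 0 < a) (hb : 0 < b)
    (hA : ∀ f : X → ℝ, (∀ x, 0 ≤ f x) → ∑ x, Q f x ^ r ≤ a * ∑ x, f x ^ r)
    (hB : ∀ f : X → ℝ, (∀ x, 0 ≤ f x) → ∑ x, Q f x ^ (2:ℝ) ≤ b * ∑ x, f x ^ (2:ℝ))
    (f : X → ℝ) (hf : ∀ x, 0 ≤ f x) :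
    ∑ x, Q f x ^ p ≤ marcC r p * (a ^ ((2 - p) / (2 - r)) * b ^ ((p - r) / (2 - r))) *
      ∑ x, f x ^ p := by
  have hp0 : 0 < p := by linarith
  set c : ℝ := (a / b) ^ (1 / (2 - r)) with hc
  have hcpos : 0 < c := by positivity
  have hκ : ∀ x, ∃ k : ℤ, 0 < Q f x → (2:ℝ) ^ k < Q f x ∧ Q f x ≤ 2 ^ (k + 1) := by
    intro x
    by_cases h : 0 < Q f x
    · obtain ⟨k, h1, h2⟩ := exists_mem_Ioc_zpow h (by norm_num : (1:ℝ) < 2)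
      exact ⟨k, fun _ => ⟨h1, h2⟩⟩
    · exact ⟨0, fun h' => absurd h' h⟩
  choose κ hκ using hκ
  set S : Finset ℤ := Finset.univ.image κ
  let f1 : ℤ → X → ℝ := fun k x => if (2:ℝ) ^ k ≤ f x / c then f x else 0
  let f2 : ℤ → X → ℝ := fun k x => if (2:ℝ) ^ k ≤ f x / c then 0 else f x
  have hf12 : ∀ k, f = f1 k + f2 k := by
    intro k; funext x; simp only [f1, f2, Pi.add_apply]; split_ifs <;> simp
  have hf1 : ∀ k x, 0 ≤ f1 k x := by
    intro k x; simp only [f1]; split_ifs; exacts [hf x, le_rfl]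
  have hf2 : ∀ k x, 0 ≤ f2 k x := by
    intro k x; simp only [f2]; split_ifs; exacts [le_rfl, hf x]
  -- pointwise
  have hpt : ∀ x, Q f x ^ p ≤ 2 ^ p * ∑ k ∈ S, ((2:ℝ) ^ k) ^ p *
      ((2 * Q (f1 k) x / 2 ^ k) ^ r + (2 * Q (f2 k) x / 2 ^ k) ^ (2:ℝ)) := by
    intro x
    have hnn : ∀ k, 0 ≤ ((2:ℝ) ^ k) ^ p *
      ((2 * Q (f1 k) x / 2 ^ k) ^ r + (2 * Q (f2 k) x / 2 ^ k) ^ (2:ℝ)) := by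
      intro k
      have := hQ0 (f1 k) x
      have := hQ0 (f2 k) x
      positivity
    rcases (hQ0 f x).eq_or_lt with h | h
    · rw [← h, Real.zero_rpow hp0.ne']
      exact mul_nonneg (by positivity) (Finset.sum_nonneg fun k _ => hnn k)
    · obtain ⟨h1, h2⟩ := hκ x h
      have hmem : κ x ∈ S := Finset.mem_image_of_mem _ (Finset.mem_univ x)
      have hs := Finset.single_le_sum (fun k _ => hnn k) hmem
      refine le_trans ?_ (mul_le_mul_of_nonneg_left hs (by positivity))
      set k := κ x
      have h2k : (0:ℝ) < 2 ^ k := by positivity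
      have h3 : Q f x ^ p ≤ 2 ^ p * ((2:ℝ) ^ k) ^ p := by
        rw [← Real.mul_rpow (by norm_num) h2k.le]
        apply Real.rpow_le_rpow h.le _ hp0.le
        rw [zpow_add_one₀ (by norm_num)] at h2; linarith
      refine h3.trans ?_
      refine mul_le_mul_of_nonneg_left ?_ (by positivity)
      refine le_mul_of_one_le_right (by positivity) ?_
      have h4 := hQ (f1 k) (f2 k) x
      rw [← hf12 k] at h4
      have n1 := hQ0 (f1 k) x
      have n2 := hQ0 (f2 k) x
      have : (2:ℝ) ^ k ≤ 2 * Q (f1 k) x ∨ (2:ℝ) ^ k ≤ 2 * Q (f2 k) x := by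
        by_contra! hcon; linarith
      rcases this with h5 | h5
      · have : 1 ≤ (2 * Q (f1 k) x / 2 ^ k) ^ r :=
          Real.one_le_rpow ((one_le_div h2k).2 h5) hr.le
        have : 0 ≤ (2 * Q (f2 k) x / 2 ^ k) ^ (2:ℝ) := by positivity
        linarith
      · have : 1 ≤ (2 * Q (f2 k) x / 2 ^ k) ^ (2:ℝ) :=
          Real.one_le_rpow ((one_le_div h2k).2 h5) (by norm_num)
        have : 0 ≤ (2 * Q (f1 k) x / 2 ^ k) ^ r := by positivity
        linarith
  have hstep : ∀ k : ℤ, ∑ x, ((2:ℝ) ^ k) ^ p *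
      ((2 * Q (f1 k) x / 2 ^ k) ^ r + (2 * Q (f2 k) x / 2 ^ k) ^ (2:ℝ)) ≤
      ∑ x, (2 ^ r * a * (((2:ℝ) ^ k) ^ (p - r) * f1 k x ^ r) +
        2 ^ (2:ℝ) * b * (((2:ℝ) ^ k) ^ (-(2 - p)) * f2 k x ^ (2:ℝ))) := by
    intro k
    have h2k : (0:ℝ) < 2 ^ k := by positivity
    have e1 : ∀ s y : ℝ, 0 ≤ y → ((2:ℝ) ^ k) ^ p * (2 * y / 2 ^ k) ^ s =
        2 ^ s * ((2:ℝ) ^ k) ^ (p - s) * y ^ s := by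
      intro s y hy
      rw [Real.div_rpow (by positivity) h2k.le, Real.mul_rpow (by norm_num) hy,
        Real.rpow_sub h2k]
      ring
    simp only [mul_add, e1 _ _ (hQ0 _ _), Finset.sum_add_distrib, ← Finset.mul_sum]
    have i1 := hA (f1 k) (hf1 k)
    have i2 := hB (f2 k) (hf2 k)
    have e2 : p - 2 = -(2 - p) := by ring
    rw [e2]
    have q1 := mul_le_mul_of_nonneg_left i1 (by positivity : 0 ≤ 2 ^ r * ((2:ℝ) ^ k) ^ (p - r))
    have q2 := mul_le_mul_of_nonneg_left i2
      (by positivity : 0 ≤ 2 ^ (2:ℝ) * ((2:ℝ) ^ k) ^ (-(2 - p)))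
    linarith
  have h1 : (2:ℝ) ^ (-(p - r)) < 1 := Real.rpow_lt_one_of_one_lt_of_neg (by norm_num) (by linarith)
  have h2 : (2:ℝ) ^ (-(2 - p)) < 1 := Real.rpow_lt_one_of_one_lt_of_neg (by norm_num) (by linarith)
  have h1' : 0 < 1 - (2:ℝ) ^ (-(p - r)) := by linarith
  have h2' : 0 < 1 - (2:ℝ) ^ (-(2 - p)) := by linarith
  set V := a ^ ((2 - p) / (2 - r)) * b ^ ((p - r) / (2 - r)) with hV
  have h2r : 0 < 2 - r := by linarith
  have hc1 : a * c ^ (-(p - r)) = V := by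
    rw [hc, ← Real.rpow_mul (by positivity), Real.div_rpow ha.le hb.le, hV, div_eq_mul_inv,
      ← Real.rpow_neg hb.le, ← mul_assoc]
    nth_rewrite 1 [← Real.rpow_one a]
    rw [← Real.rpow_add ha]
    congr 2
    · field_simp; ring
    · field_simp
  have hc2 : b * c ^ (2 - p) = V := by
    rw [hc, ← Real.rpow_mul (by positivity), Real.div_rpow ha.le hb.le, hV, div_eq_mul_inv,
      ← Real.rpow_neg hb.le]
    nth_rewrite 1 [← Real.rpow_one b]
    rw [mul_left_comm, ← Real.rpow_add hb]
    congr 2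
    · field_simp
    · field_simp; ring
  have hx : ∀ x, ∑ k ∈ S, (2 ^ r * a * (((2:ℝ) ^ k) ^ (p - r) * f1 k x ^ r) +
        2 ^ (2:ℝ) * b * (((2:ℝ) ^ k) ^ (-(2 - p)) * f2 k x ^ (2:ℝ))) ≤
      (2 ^ r / (1 - 2 ^ (-(p - r))) + 2 ^ (2:ℝ) / (1 - 2 ^ (-(2 - p)))) * V * f x ^ p := by
    intro x
    rcases (hf x).eq_or_lt with h | h
    · have e1 : ∀ k, f1 k x = 0 := by intro k; simp [f1, ← h]
      have e2 : ∀ k, f2 k x = 0 := by intro k; simp [f2, ← h]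
      simp only [e1, e2, ← h]
      rw [Real.zero_rpow hr.ne', Real.zero_rpow hp0.ne']; simp
    · have hfc : 0 < f x / c := by positivity
      rw [Finset.sum_add_distrib, ← Finset.mul_sum, ← Finset.mul_sum]
      have e1 : ∑ k ∈ S, ((2:ℝ) ^ k) ^ (p - r) * f1 k x ^ r ≤
          f x ^ r * ((f x / c) ^ (p - r) / (1 - 2 ^ (-(p - r)))) := by
        refine le_trans (le_of_eq ?_) (mul_le_mul_of_nonneg_left
          (geoA (p - r) (by linarith) S _ hfc) (by positivity))
        rw [Finset.mul_sum]
        refine Finset.sum_congr rfl fun k _ => ?_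
        simp only [f1]; split_ifs
        · ring
        · rw [Real.zero_rpow hr.ne']; ring
      have e2 : ∑ k ∈ S, ((2:ℝ) ^ k) ^ (-(2 - p)) * f2 k x ^ (2:ℝ) ≤
          f x ^ (2:ℝ) * ((f x / c) ^ (-(2 - p)) / (1 - 2 ^ (-(2 - p)))) := by
        refine le_trans ?_ (mul_le_mul_of_nonneg_left
          (geoB (2 - p) (by linarith) S _ hfc) (by positivity))
        rw [Finset.mul_sum]
        refine Finset.sum_le_sum fun k _ => ?_
        simp only [f2]; split_ifs with c1 c2
        · rw [Real.zero_rpow (by norm_num)]; simp; positivity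
        · rw [Real.zero_rpow (by norm_num)]; simp
        · exact le_of_eq (by ring)
        · exfalso; linarith
      have e3 : f x ^ r * ((f x / c) ^ (p - r)) = c ^ (-(p - r)) * f x ^ p := by
        rw [Real.div_rpow h.le hcpos.le, Real.rpow_neg hcpos.le]
        have : f x ^ p = f x ^ r * f x ^ (p - r) := by rw [← Real.rpow_add h]; congr 1; ring
        rw [this]; field_simp
      have e4 : f x ^ (2:ℝ) * ((f x / c) ^ (-(2 - p))) = c ^ (2 - p) * f x ^ p := by
        rw [Real.div_rpow h.le hcpos.le, Real.rpow_neg hcpos.le, div_inv_eq_mul]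
        have : f x ^ p = f x ^ (2:ℝ) * f x ^ (-(2 - p)) := by
          rw [← Real.rpow_add h]; congr 1; ring
        rw [this]; ring
      have q1 := mul_le_mul_of_nonneg_left e1 (by positivity : 0 ≤ 2 ^ r * a)
      have q2 := mul_le_mul_of_nonneg_left e2 (by positivity : 0 ≤ 2 ^ (2:ℝ) * b)
      refine (add_le_add q1 q2).trans (le_of_eq ?_)
      rw [← mul_div_assoc (f x ^ r), ← mul_div_assoc (f x ^ (2:ℝ)), e3, e4, add_mul, add_mul]
      nth_rewrite 1 [← hc1]
      rw [← hc2]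
      ring
  calc ∑ x, Q f x ^ p ≤ ∑ x, 2 ^ p * ∑ k ∈ S, ((2:ℝ) ^ k) ^ p *
      ((2 * Q (f1 k) x / 2 ^ k) ^ r + (2 * Q (f2 k) x / 2 ^ k) ^ (2:ℝ)) :=
        Finset.sum_le_sum fun x _ => hpt x
    _ = 2 ^ p * ∑ k ∈ S, ∑ x, ((2:ℝ) ^ k) ^ p *
      ((2 * Q (f1 k) x / 2 ^ k) ^ r + (2 * Q (f2 k) x / 2 ^ k) ^ (2:ℝ)) := by
        rw [← Finset.mul_sum, Finset.sum_comm]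
    _ ≤ 2 ^ p * ∑ k ∈ S, ∑ x, (2 ^ r * a * (((2:ℝ) ^ k) ^ (p - r) * f1 k x ^ r) +
        2 ^ (2:ℝ) * b * (((2:ℝ) ^ k) ^ (-(2 - p)) * f2 k x ^ (2:ℝ))) := by
        refine mul_le_mul_of_nonneg_left (Finset.sum_le_sum fun k _ => hstep k) (by positivity)
    _ = 2 ^ p * ∑ x, ∑ k ∈ S, (2 ^ r * a * (((2:ℝ) ^ k) ^ (p - r) * f1 k x ^ r) +
        2 ^ (2:ℝ) * b * (((2:ℝ) ^ k) ^ (-(2 - p)) * f2 k x ^ (2:ℝ))) := by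
        rw [Finset.sum_comm]
    _ ≤ 2 ^ p * ∑ x, (2 ^ r / (1 - 2 ^ (-(p - r))) + 2 ^ (2:ℝ) / (1 - 2 ^ (-(2 - p)))) * V
        * f x ^ p := by
        refine mul_le_mul_of_nonneg_left (Finset.sum_le_sum fun x _ => hx x) (by positivity)
    _ = _ := by rw [← Finset.mul_sum, marcC]; ring


lemma young1 (r a b : ℝ) (hr : 1 < r) (ha : 0 ≤ a) (hb : 0 ≤ b) :
    r * (b * a ^ (r - 1)) ≤ b ^ r + (r - 1) * a ^ r := by
  have hc : r.HolderConjugate (r / (r - 1)) := by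
    rw [Real.holderConjugate_iff]
    refine ⟨hr, ?_⟩
    field_simp
    ring
  have h := Real.young_inequality_of_nonneg hb (Real.rpow_nonneg ha (r - 1)) hc
  rw [← Real.rpow_mul ha] at h
  have e : (r - 1) * (r / (r - 1)) = r := by
    have : r - 1 ≠ 0 := by linarith
    field_simp
  rw [e] at h
  have h2 := mul_le_mul_of_nonneg_left h (by linarith : (0:ℝ) ≤ r)
  have e2 : r * (b ^ r / r + a ^ r / (r / (r - 1))) = b ^ r + (r - 1) * a ^ r := by
    have : r - 1 ≠ 0 := by linarith
    have : r ≠ 0 := by linarith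
    field_simp
  linarith

lemma concav1 (r t a : ℝ) (hr : 1 < r) (hr2 : r < 2) (ha : 0 ≤ a) (ht : 0 < t) :
    (r - 1) * t ^ (r - 2) * (t - a) ≤ t ^ (r - 1) - a ^ (r - 1) := by
  have h := rpow_one_add_le_one_add_mul_self (s := a / t - 1)
    (by have := div_nonneg ha ht.le; linarith) (p := r - 1) (by linarith) (by linarith)
  have e : 1 + (a / t - 1) = a / t := by ring
  rw [e, Real.div_rpow ha ht.le] at h
  have hp : 0 < t ^ (r - 1) := Real.rpow_pos_of_pos ht _
  rw [div_le_iff₀ hp] at h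
  have e3 : t ^ (r - 1) = t ^ (r - 2) * t := by
    rw [← Real.rpow_add_one ht.ne']; congr 1; ring
  have e4 : (1 + (r - 1) * (a / t - 1)) * t ^ (r - 1)
      = t ^ (r - 1) + (r - 1) * t ^ (r - 2) * (a - t) := by
    rw [e3]; field_simp
  rw [e4] at h
  nlinarith

lemma taylor1 (r a b m : ℝ) (hr : 1 < r) (hr2 : r < 2) (ha : 0 ≤ a) (hb : 0 ≤ b)
    (ham : a ≤ m) (hbm : b ≤ m) (hm : 0 < m) :
    (r * (r - 1) / 2) * ((b - a) ^ 2 / m ^ (2 - r)) ≤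
      b ^ r - a ^ r - r * a ^ (r - 1) * (b - a) := by
  set c := m ^ (r - 2) with hc
  have hcdiv : (b - a) ^ 2 / m ^ (2 - r) = (b - a) ^ 2 * c := by
    rw [hc, div_eq_mul_inv, ← Real.rpow_neg hm.le]; congr 2; ring
  have hcpos : 0 < c := Real.rpow_pos_of_pos hm _
  rw [hcdiv]
  have key : ∀ t, 0 < t → t ≤ m → ∀ s, 0 ≤ s → s ≤ t →
      (r - 1) * c * (t - s) ≤ t ^ (r - 1) - s ^ (r - 1) := by
    intro t ht htm s hs hst
    refine le_trans ?_ (concav1 r t s hr hr2 hs ht)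
    have : c ≤ t ^ (r - 2) := Real.rpow_le_rpow_of_nonpos ht htm (by linarith)
    have h1 : 0 ≤ t - s := by linarith
    have h2 : 0 ≤ r - 1 := by linarith
    gcongr
  let g : ℝ → ℝ := fun t => t ^ r - a ^ r - r * a ^ (r - 1) * (t - a) -
    (r * (r - 1) / 2) * ((t - a) ^ 2 * c)
  have hd : ∀ t, HasDerivAt g (r * t ^ (r - 1) - r * a ^ (r - 1) -
      (r * (r - 1) / 2) * (2 * (t - a) * c)) t := by
    intro t
    have h1 := Real.hasDerivAt_rpow_const (x := t) (p := r) (Or.inr hr.le)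
    have h2 : HasDerivAt (fun t : ℝ => t - a) 1 t := (hasDerivAt_id t).sub_const a
    have h3 := ((h1.sub_const (a ^ r)).sub (h2.const_mul (r * a ^ (r - 1)))).sub
      ((((h2.pow 2)).mul_const c).const_mul (r * (r - 1) / 2))
    refine h3.congr_deriv ?_
    simp
  have hga : g a = 0 := by simp [g]
  suffices 0 ≤ g b by simp only [g] at this; linarith
  have hcont : Continuous g := continuous_iff_continuousAt.2 fun t => (hd t).continuousAt
  rw [← hga]
  rcases le_total a b with hab | hab
  · have : MonotoneOn g (Set.Icc a b) := by
      apply monotoneOn_of_deriv_nonneg (convex_Icc a b) hcont.continuousOn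
        (fun t _ => (hd t).differentiableAt.differentiableWithinAt)
      intro t ht
      rw [interior_Icc] at ht
      rw [(hd t).deriv]
      have := key t (by linarith [ht.1]) (by linarith [ht.2]) a ha ht.1.le
      nlinarith
    exact this ⟨le_rfl, hab⟩ ⟨hab, le_rfl⟩ hab
  · have : AntitoneOn g (Set.Icc b a) := by
      apply antitoneOn_of_deriv_nonpos (convex_Icc b a) hcont.continuousOn
        (fun t _ => (hd t).differentiableAt.differentiableWithinAt)
      intro t ht
      rw [interior_Icc] at ht
      rw [(hd t).deriv]
      have := key a (by linarith [ht.1, ht.2]) ham t (by linarith [ht.1]) ht.2.le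
      nlinarith
    exact this ⟨le_rfl, hab⟩ ⟨hab, le_rfl⟩ hab

def runMax {X : Type*} (E : ℕ → X → ℝ) : ℕ → X → ℝ
  | 0 => E 0
  | i + 1 => fun x => max (runMax E i x) (E (i + 1) x)

lemma le_runMax {X : Type*} (E : ℕ → X → ℝ) (K i : ℕ) (h : i ≤ K) (x : X) :
    E i x ≤ runMax E K x := by
  induction K with
  | zero => obtain rfl : i = 0 := by omega
            exact le_rfl
  | succ K ih =>
    rcases Nat.lt_or_ge K i with h1 | h1
    · obtain rfl : i = K + 1 := by omega
      exact le_max_right _ _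
    · exact (ih h1).trans (le_max_left _ _)

section mart
variable {X : Type*} [Fintype X]

lemma doob (r : ℝ) (hr : 1 < r) (K : ℕ) (E : ℕ → X → ℝ) (R : ℕ → X → X → Prop)
    (hE0 : ∀ i x, 0 ≤ E i x) (hanti : ∀ i x y, R (i + 1) x y → R i x y)
    (hmeas : ∀ i ≤ K, ∀ x y, R i x y → E i x = E i y)
    (hmart : ∀ i ≤ K, ∀ h : X → ℝ, (∀ x y, R i x y → h x = h y) →
      ∑ x, h x * E i x = ∑ x, h x * E K x) :
    ∑ x, (runMax E K x) ^ r ≤ (r / (r - 1)) ^ r * ∑ x, (E K x) ^ r := by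
  have hM0 : ∀ i x, 0 ≤ runMax E i x := fun i x => (hE0 0 x).trans (le_runMax E i 0 (by omega) x)
  have hr1 : 0 < r - 1 := by linarith
  have hr0 : 0 < r := by linarith
  have hMmeas : ∀ i ≤ K, ∀ x y, R i x y → runMax E i x = runMax E i y := by
    intro i
    induction i with
    | zero => intro hi x y h; exact hmeas 0 hi x y h
    | succ i ih =>
      intro hi x y h
      simp only [runMax]
      rw [ih (by omega) x y (hanti i x y h), hmeas (i + 1) hi x y h]
  have key : ∀ i ≤ K, (r - 1) * ∑ x, (runMax E i x) ^ r ≤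
      r * ∑ x, (runMax E i x) ^ (r - 1) * E K x := by
    intro i
    induction i with
    | zero =>
      intro hi
      rw [← hmart 0 hi (fun x => (runMax E 0 x) ^ (r - 1))
        (fun x y h => by simp only [hMmeas 0 hi x y h])]
      rw [Finset.mul_sum, Finset.mul_sum]
      refine Finset.sum_le_sum fun x _ => ?_
      have := young1 r (E 0 x) 0 hr (hE0 0 x) le_rfl
      simp only [runMax]
      have e : E 0 x ^ (r - 1) * E 0 x = E 0 x ^ r := by
        rcases (hE0 0 x).eq_or_lt with h | h
        · rw [← h, Real.zero_rpow hr0.ne']; simp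
        · rw [← Real.rpow_add_one h.ne']; congr 1; ring
      rw [e]
      have := Real.rpow_nonneg (hE0 0 x) r
      nlinarith
    | succ i ih =>
      intro hi
      have ih := ih (by omega)
      have h1 := hmart (i + 1) hi (fun x => (runMax E (i + 1) x) ^ (r - 1)
          - (runMax E i x) ^ (r - 1)) (fun x y h => by
            simp only [hMmeas (i + 1) hi x y h, hMmeas i (by omega) x y (hanti i x y h)])
      have h2 : (r - 1) * ∑ x, ((runMax E (i + 1) x) ^ r - (runMax E i x) ^ r) ≤
          r * ∑ x, (runMax E (i + 1) x ^ (r - 1) - runMax E i x ^ (r - 1)) * E (i + 1) x := by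
        rw [Finset.mul_sum, Finset.mul_sum]
        refine Finset.sum_le_sum fun x _ => ?_
        simp only [runMax]
        rcases le_total (E (i + 1) x) (runMax E i x) with h | h
        · rw [max_eq_left h]; simp
        · rw [max_eq_right h]
          have := young1 r (runMax E i x) (E (i + 1) x) hr (hM0 i x) (hE0 _ x)
          have e : E (i + 1) x ^ (r - 1) * E (i + 1) x = E (i + 1) x ^ r := by
            rcases (hE0 (i + 1) x).eq_or_lt with h | h
            · rw [← h, Real.zero_rpow hr0.ne']; simp
            · rw [← Real.rpow_add_one h.ne']; congr 1; ring
          have e5 : (E (i + 1) x ^ (r - 1) - runMax E i x ^ (r - 1)) * E (i + 1) x =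
            E (i + 1) x ^ r - E (i + 1) x * runMax E i x ^ (r - 1) := by rw [← e]; ring
          rw [e5]
          linarith
      rw [h1] at h2
      simp only [sub_mul, Finset.sum_sub_distrib] at h2
      linarith
  have hk := key K le_rfl
  have hc : (r / (r - 1)).HolderConjugate r := by
    rw [Real.holderConjugate_iff]
    refine ⟨by rw [lt_div_iff₀ hr1]; linarith, ?_⟩
    field_simp
    ring
  have hH := Real.inner_le_Lp_mul_Lq_of_nonneg Finset.univ hc
    (f := fun x => runMax E K x ^ (r - 1)) (g := fun x => E K x)
    (fun x _ => Real.rpow_nonneg (hM0 K x) _) (fun x _ => hE0 K x)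
  have e : ∀ x, (runMax E K x ^ (r - 1)) ^ (r / (r - 1)) = runMax E K x ^ r := by
    intro x; rw [← Real.rpow_mul (hM0 K x)]; congr 1; field_simp
  simp only [e] at hH
  set A := ∑ x, runMax E K x ^ r
  set B := ∑ x, E K x ^ r
  have hA : 0 ≤ A := Finset.sum_nonneg fun x _ => Real.rpow_nonneg (hM0 K x) _
  have hB : 0 ≤ B := Finset.sum_nonneg fun x _ => Real.rpow_nonneg (hE0 K x) _
  rcases hA.eq_or_lt with h | hApos
  · rw [← h]; positivity
  have h3 : A ≤ (r / (r - 1)) * (A ^ (1 / (r / (r - 1))) * B ^ (1 / r)) := by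
    have : A = (1 / (r - 1)) * ((r - 1) * A) := by field_simp
    rw [this]
    calc _ ≤ (1 / (r - 1)) * (r * ∑ x, runMax E K x ^ (r - 1) * E K x) := by gcongr
      _ ≤ (1 / (r - 1)) * (r * (A ^ (1 / (r / (r - 1))) * B ^ (1 / r))) := by gcongr
      _ = _ := by rw [← this]; ring
  have h4 : A ^ (1 / r) ≤ (r / (r - 1)) * B ^ (1 / r) := by
    have e2 : A = A ^ (1 / (r / (r - 1))) * A ^ (1 / r) := by
      rw [← Real.rpow_add hApos]
      have : 1 / (r / (r - 1)) + 1 / r = 1 := by field_simp; ring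
      rw [this, Real.rpow_one]
    have hp : 0 < A ^ (1 / (r / (r - 1))) := Real.rpow_pos_of_pos hApos _
    have : A ^ (1 / (r / (r - 1))) * A ^ (1 / r) ≤ A ^ (1 / (r / (r - 1))) *
      ((r / (r - 1)) * B ^ (1 / r)) := by rw [← e2]; linarith
    exact le_of_mul_le_mul_left this hp
  have h5 := Real.rpow_le_rpow (Real.rpow_nonneg hA _) h4 hr0.le
  rw [Real.mul_rpow (by positivity) (by positivity), ← Real.rpow_mul hA, ← Real.rpow_mul hB] at h5
  have : 1 / r * r = 1 := by field_simp
  rwa [this, Real.rpow_one, Real.rpow_one] at h5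

lemma sqfun (r : ℝ) (hr : 1 < r) (hr2 : r < 2) (K : ℕ) (E : ℕ → X → ℝ) (R : ℕ → X → X → Prop)
    (hE0 : ∀ i x, 0 ≤ E i x) (hanti : ∀ i x y, R (i + 1) x y → R i x y)
    (hmeas : ∀ i ≤ K, ∀ x y, R i x y → E i x = E i y)
    (hmart : ∀ i ≤ K, ∀ h : X → ℝ, (∀ x y, R i x y → h x = h y) →
      ∑ x, h x * E i x = ∑ x, h x * E K x) :
    ∑ x, ((E 0 x) ^ 2 + ∑ i ∈ Finset.range K, (E (i + 1) x - E i x) ^ 2) /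
      (runMax E K x) ^ (2 - r) ≤ (2 / (r * (r - 1))) * ∑ x, (E K x) ^ r := by
  have hM0 : ∀ i x, 0 ≤ runMax E i x := fun i x => (hE0 0 x).trans (le_runMax E i 0 (by omega) x)
  have hr1 : 0 < r - 1 := by linarith
  have hr0 : 0 < r := by linarith
  set c := r * (r - 1) / 2 with hc
  have hcpos : 0 < c := by positivity
  have hc1 : c ≤ 1 := by rw [hc]; nlinarith
  set D : X → ℝ := fun x => (runMax E K x) ^ (2 - r) with hD
  have hcase : ∀ x, (∀ i ≤ K, E i x = 0) ∨ 0 < runMax E K x := by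
    intro x
    rcases (hM0 K x).eq_or_lt with h | h
    · left; intro i hi
      exact le_antisymm ((le_runMax E K i hi x).trans h.symm.le) (hE0 i x)
    · exact Or.inr h
  have key : ∀ k ≤ K, c * ∑ x, ((E 0 x) ^ 2 + ∑ i ∈ Finset.range k, (E (i + 1) x - E i x) ^ 2) / D x
      ≤ ∑ x, (E k x) ^ r := by
    intro k
    induction k with
    | zero =>
      intro hk
      rw [Finset.mul_sum]
      refine Finset.sum_le_sum fun x _ => ?_
      simp only [Finset.range_zero, Finset.sum_empty, add_zero]
      rcases hcase x with h | h
      · rw [h 0 (by omega), Real.zero_rpow hr0.ne']; simp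
      · have := taylor1 r 0 (E 0 x) (runMax E K x) hr hr2 le_rfl (hE0 0 x) (hM0 K x)
          (le_runMax E K 0 (by omega) x) h
        rw [Real.zero_rpow hr0.ne', Real.zero_rpow hr1.ne'] at this
        simpa using this
    | succ k ih =>
      intro hk
      have ih := ih (by omega)
      have h1 : ∑ x, c * ((E (k + 1) x - E k x) ^ 2 / D x) ≤
          ∑ x, (E (k + 1) x ^ r - E k x ^ r - r * E k x ^ (r - 1) * (E (k + 1) x - E k x)) := by
        refine Finset.sum_le_sum fun x _ => ?_
        rcases hcase x with h | h
        · rw [h k (by omega), h (k + 1) hk]; simp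
        · exact taylor1 r (E k x) (E (k + 1) x) (runMax E K x) hr hr2 (hE0 _ x) (hE0 _ x)
            (le_runMax E K k (by omega) x) (le_runMax E K _ hk x) h
      have h2 := hmart k (by omega) (fun x => E k x ^ (r - 1))
        (fun x y h => by simp only [hmeas k (by omega) x y h])
      have h3 := hmart (k + 1) hk (fun x => E k x ^ (r - 1))
        (fun x y h => by simp only [hmeas k (by omega) x y (hanti k x y h)])
      have h4 : ∑ x, r * E k x ^ (r - 1) * (E (k + 1) x - E k x) = 0 := by
        have : ∀ x, r * E k x ^ (r - 1) * (E (k + 1) x - E k x) =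
          r * (E k x ^ (r - 1) * E (k + 1) x) - r * (E k x ^ (r - 1) * E k x) := fun x => by ring
        simp only [this, Finset.sum_sub_distrib, ← Finset.mul_sum]
        rw [h2, h3]; ring
      rw [Finset.sum_sub_distrib, h4, Finset.sum_sub_distrib, ← Finset.mul_sum] at h1
      simp only [Finset.sum_range_succ, ← add_assoc, add_div _ _ (D _),
        Finset.sum_add_distrib] at ih ⊢
      linarith
  have := key K le_rfl
  have e : 2 / (r * (r - 1)) = c⁻¹ := by rw [hc]; field_simp
  rw [e, ← div_eq_inv_mul, le_div_iff₀ hcpos]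
  linarith
end mart


section conv
variable {G : Type} [Fintype G] [AddCommGroup G]

def cv (w f : G → ℝ) (x : G) : ℝ := ∑ y, w y * f (x - y)

structure IsProb (w : G → ℝ) : Prop where
  nonneg : ∀ y, 0 ≤ w y
  sum_one : ∑ y, w y = 1

lemma cv_mono {w : G → ℝ} (hw : IsProb w) {f g : G → ℝ} (h : ∀ x, f x ≤ g x) (x : G) :
    cv w f x ≤ cv w g x :=
  Finset.sum_le_sum fun y _ => mul_le_mul_of_nonneg_left (h _) (hw.nonneg y)

lemma cv_nonneg {w : G → ℝ} (hw : IsProb w) {f : G → ℝ} (h : ∀ x, 0 ≤ f x) (x : G) :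
    0 ≤ cv w f x := Finset.sum_nonneg fun y _ => mul_nonneg (hw.nonneg y) (h _)

lemma sum_cv {w : G → ℝ} (hw : IsProb w) (f : G → ℝ) : ∑ x, cv w f x = ∑ x, f x := by
  unfold cv
  rw [Finset.sum_comm]
  have : ∀ y, ∑ x, w y * f (x - y) = w y * ∑ x, f x := by
    intro y
    rw [← Finset.mul_sum]
    congr 1
    exact Equiv.sum_comp (Equiv.subRight y) f
  simp only [this]
  rw [← Finset.sum_mul, hw.sum_one, one_mul]

lemma abs_cv_le {w : G → ℝ} (hw : IsProb w) (f : G → ℝ) (x : G) :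
    |cv w f x| ≤ cv w (fun y => |f y|) x := by
  refine (Finset.abs_sum_le_sum_abs _ _).trans (le_of_eq ?_)
  refine Finset.sum_congr rfl fun y _ => ?_
  rw [abs_mul, abs_of_nonneg (hw.nonneg y)]

lemma cv_add (w f g : G → ℝ) : cv w (f + g) = cv w f + cv w g := by
  funext x; simp [cv, mul_add, Finset.sum_add_distrib]

lemma cv_sub_left (w w' f : G → ℝ) : cv (w - w') f = cv w f - cv w' f := by
  funext x; simp [cv, sub_mul, Finset.sum_sub_distrib]

lemma cv_sq_le {w : G → ℝ} (hw : IsProb w) (g a b : G → ℝ) (ha : ∀ x, 0 ≤ a x) (hb : ∀ x, 0 ≤ b x)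
    (h : ∀ x, g x ^ 2 = a x * b x) (x : G) : (cv w g x) ^ 2 ≤ cv w a x * cv w b x := by
  unfold cv
  apply Finset.sum_sq_le_sum_mul_sum_of_sq_eq_mul
  · intro y _; exact mul_nonneg (hw.nonneg y) (ha _)
  · intro y _; exact mul_nonneg (hw.nonneg y) (hb _)
  · intro y _; rw [mul_pow, h]; ring

lemma cv_rpow_le {w : G → ℝ} (hw : IsProb w) (f : G → ℝ) (hf : ∀ x, 0 ≤ f x) (p : ℝ) (hp : 1 ≤ p)
    (x : G) : (cv w f x) ^ p ≤ cv w (fun y => f y ^ p) x :=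
  Real.rpow_arith_mean_le_arith_mean_rpow Finset.univ w _ (fun y _ => hw.nonneg y) hw.sum_one
    (fun y _ => hf _) hp

noncomputable def ft (f : G → ℝ) (ψ : AddChar G ℂ) : ℂ := ∑ x, (f x : ℂ) * ψ x

lemma ft_sub (f g : G → ℝ) (ψ : AddChar G ℂ) : ft (f - g) ψ = ft f ψ - ft g ψ := by
  simp [ft, sub_mul, Finset.sum_sub_distrib]

lemma ft_cv (w f : G → ℝ) (ψ : AddChar G ℂ) : ft (cv w f) ψ = ft w ψ * ft f ψ := by
  unfold ft cv
  push_cast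
  simp only [Finset.sum_mul]
  rw [Finset.sum_comm]
  refine Finset.sum_congr rfl fun y _ => ?_
  rw [Finset.mul_sum]
  refine Eq.trans ?_ (Equiv.sum_comp (Equiv.subRight y)
    (fun x => (w y : ℂ) * ψ y * ((f x : ℂ) * ψ x)))
  refine Finset.sum_congr rfl fun x _ => ?_
  simp only [Equiv.subRight_apply]
  have : ψ x = ψ y * ψ (x - y) := by rw [← AddChar.map_add_eq_mul]; congr 1; abel
  rw [this]; ring

lemma parseval (f : G → ℝ) :
    ∑ ψ : AddChar G ℂ, ‖ft f ψ‖ ^ 2 = (Fintype.card G : ℝ) * ∑ x, f x ^ 2 := by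
  classical
  have h : ∀ ψ : AddChar G ℂ, ((‖ft f ψ‖ ^ 2 : ℝ) : ℂ) =
      ∑ x, ∑ y, (f x : ℂ) * f y * ψ (x - y) := by
    intro ψ
    have := Complex.mul_conj' (ft f ψ)
    push_cast
    rw [← this]
    unfold ft
    rw [map_sum, Finset.sum_mul_sum]
    refine Finset.sum_congr rfl fun x _ => Finset.sum_congr rfl fun y _ => ?_
    rw [map_mul, Complex.conj_ofReal, sub_eq_add_neg, AddChar.map_add_eq_mul,
      AddChar.map_neg_eq_conj]
    ring
  have h2 : ((∑ ψ : AddChar G ℂ, ‖ft f ψ‖ ^ 2 : ℝ) : ℂ) =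
      (((Fintype.card G : ℝ) * ∑ x, f x ^ 2 : ℝ) : ℂ) := by
    rw [Complex.ofReal_sum]
    simp only [h]
    rw [Finset.sum_comm]
    have : ∀ x, ∑ ψ : AddChar G ℂ, ∑ y, (f x : ℂ) * f y * ψ (x - y) =
        (Fintype.card G : ℂ) * (f x) ^ 2 := by
      intro x
      rw [Finset.sum_comm]
      simp only [← Finset.mul_sum, AddChar.sum_apply_eq_ite, sub_eq_zero]
      simp
      ring
    simp only [this]
    push_cast
    rw [Finset.mul_sum]
  exact_mod_cast h2

lemma l2bound {I : Type*} (s : Finset I) (a b : I → G → ℝ) (C : ℝ)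
    (h : ∀ ψ, ∑ i ∈ s, ‖ft (a i) ψ‖ ^ 2 * ‖ft (b i) ψ‖ ^ 2 ≤ C) (f : G → ℝ) :
    ∑ x, ∑ i ∈ s, (cv (a i) (cv (b i) f) x) ^ 2 ≤ C * ∑ x, f x ^ 2 := by
  have hc : (0:ℝ) < Fintype.card G := by exact_mod_cast Fintype.card_pos
  refine le_of_mul_le_mul_left ?_ hc
  calc (Fintype.card G : ℝ) * ∑ x, ∑ i ∈ s, (cv (a i) (cv (b i) f) x) ^ 2
      = ∑ i ∈ s, (Fintype.card G : ℝ) * ∑ x, (cv (a i) (cv (b i) f) x) ^ 2 := by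
        rw [Finset.sum_comm, Finset.mul_sum]
    _ = ∑ i ∈ s, ∑ ψ, ‖ft (a i) ψ‖ ^ 2 * ‖ft (b i) ψ‖ ^ 2 * ‖ft f ψ‖ ^ 2 := by
        refine Finset.sum_congr rfl fun i _ => ?_
        rw [← parseval]
        refine Finset.sum_congr rfl fun ψ _ => ?_
        rw [ft_cv, ft_cv, norm_mul, norm_mul]; ring
    _ = ∑ ψ, (∑ i ∈ s, ‖ft (a i) ψ‖ ^ 2 * ‖ft (b i) ψ‖ ^ 2) * ‖ft f ψ‖ ^ 2 := by
        rw [Finset.sum_comm]; simp only [Finset.sum_mul]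
    _ ≤ ∑ ψ, C * ‖ft f ψ‖ ^ 2 :=
        Finset.sum_le_sum fun ψ _ => mul_le_mul_of_nonneg_right (h ψ) (by positivity)
    _ = _ := by rw [← Finset.mul_sum, parseval]; ring

lemma vec (p r : ℝ) (hp : 1 < p) (hr : r = 2 * p / (p + 1)) {I : Type*} (s : Finset I)
    (w w' : I → G → ℝ) (hw : ∀ i ∈ s, IsProb (w i)) (hw' : ∀ i ∈ s, IsProb (w' i))
    (g : I → G → ℝ) (u m : G → ℝ) (hu : ∀ x, 0 ≤ u x) (hm0 : ∀ x, 0 ≤ m x)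
    (hg : ∀ i ∈ s, ∀ x, u x = 0 → g i x = 0)
    (hm : ∀ i ∈ s, ∀ x, cv (w i) u x ≤ m x) (hm' : ∀ i ∈ s, ∀ x, cv (w' i) u x ≤ m x) :
    ∑ x, (√(∑ i ∈ s, (cv (w i - w' i) (g i) x) ^ 2)) ^ r ≤
      (4 * ∑ i ∈ s, ∑ x, g i x ^ 2 / u x) ^ (r / 2) * (∑ x, m x ^ p) ^ (1 - r / 2) := by
  have hr0 : 0 < r := by rw [hr]; positivity
  have hr2 : r < 2 := by rw [hr, div_lt_iff₀ (by linarith)]; linarith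
  let q : I → G → ℝ := fun i x => g i x ^ 2 / u x
  have hq : ∀ i x, 0 ≤ q i x := fun i x => div_nonneg (sq_nonneg _) (hu x)
  let H : G → ℝ := fun x => 2 * ∑ i ∈ s, (cv (w i) (q i) x + cv (w' i) (q i) x)
  have hH0 : ∀ x, 0 ≤ H x := fun x => mul_nonneg (by norm_num) (Finset.sum_nonneg fun i hi =>
    add_nonneg (cv_nonneg (hw i hi) (hq i) x) (cv_nonneg (hw' i hi) (hq i) x))
  have hHs : ∑ x, H x = 4 * ∑ i ∈ s, ∑ x, g i x ^ 2 / u x := by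
    simp only [H]
    rw [← Finset.mul_sum, Finset.sum_comm]
    have : ∀ i ∈ s, ∑ x, (cv (w i) (q i) x + cv (w' i) (q i) x) = 2 * ∑ x, g i x ^ 2 / u x := by
      intro i hi
      rw [Finset.sum_add_distrib, sum_cv (hw i hi), sum_cv (hw' i hi)]; ring
    rw [Finset.sum_congr rfl this, ← Finset.mul_sum]; ring
  have h1 : ∀ (v : G → ℝ), IsProb v → ∀ i ∈ s, ∀ x, cv v u x ≤ m x →
      (cv v (g i) x) ^ 2 ≤ cv v (q i) x * m x := by
    intro v hv i hi x hmx
    refine (cv_sq_le hv (g i) (q i) u (hq i) hu ?_ x).trans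
      (mul_le_mul_of_nonneg_left hmx (cv_nonneg hv (hq i) x))
    intro y
    by_cases h : u y = 0
    · simp [q, h, hg i hi y h]
    · simp only [q]; field_simp
  have hpt : ∀ x, ∑ i ∈ s, (cv (w i - w' i) (g i) x) ^ 2 ≤ H x * m x := by
    intro x
    simp only [H]
    rw [mul_assoc, Finset.sum_mul, Finset.mul_sum]
    refine Finset.sum_le_sum fun i hi => ?_
    rw [cv_sub_left]
    have a1 := h1 _ (hw i hi) i hi x (hm i hi x)
    have a2 := h1 _ (hw' i hi) i hi x (hm' i hi x)
    simp only [Pi.sub_apply]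
    nlinarith [sq_nonneg (cv (w i) (g i) x + cv (w' i) (g i) x)]
  have hc : (2 / r).HolderConjugate (2 / (2 - r)) := by
    rw [Real.holderConjugate_iff]
    refine ⟨by rw [lt_div_iff₀ hr0]; linarith, ?_⟩
    field_simp; ring
  have hH := Real.inner_le_Lp_mul_Lq_of_nonneg Finset.univ hc
    (f := fun x => H x ^ (r / 2)) (g := fun x => m x ^ (r / 2))
    (fun x _ => Real.rpow_nonneg (hH0 x) _) (fun x _ => Real.rpow_nonneg (hm0 x) _)
  have e1 : ∀ x, (H x ^ (r / 2)) ^ (2 / r) = H x := by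
    intro x; rw [← Real.rpow_mul (hH0 x)]
    have : r / 2 * (2 / r) = 1 := by field_simp
    rw [this, Real.rpow_one]
  have e2 : ∀ x, (m x ^ (r / 2)) ^ (2 / (2 - r)) = m x ^ p := by
    intro x; rw [← Real.rpow_mul (hm0 x)]
    congr 1
    rw [hr]
    have : p + 1 ≠ 0 := by linarith
    have h2 : 2 - 2 * p / (p + 1) = 2 / (p + 1) := by field_simp; ring
    rw [h2]
    field_simp
  simp only [e1, e2, hHs] at hH
  have e3 : 1 / (2 / r) = r / 2 := by field_simp
  have e4 : 1 / (2 / (2 - r)) = 1 - r / 2 := by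
    have : 2 - r ≠ 0 := by linarith
    field_simp
  rw [e3, e4] at hH
  refine le_trans (Finset.sum_le_sum fun x _ => ?_) hH
  rw [Real.sqrt_eq_rpow, ← Real.rpow_mul (Finset.sum_nonneg fun i _ => sq_nonneg _),
    ← Real.mul_rpow (hH0 x) (hm0 x)]
  have e5 : 1 / 2 * r = r / 2 := by ring
  rw [e5]
  exact Real.rpow_le_rpow (Finset.sum_nonneg fun i _ => sq_nonneg _) (hpt x) (by linarith)

end conv


def idx (K l s : ℕ) : Finset (ℕ × ℕ × ℕ) :=
  (Finset.range K ×ˢ Finset.range (K + 1) ×ˢ Finset.range (2 ^ l)).filter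
    fun i => l ≤ i.1 ∧ (i.2.1 - i.1) + (i.1 - i.2.1) = s

lemma idx_sum (K l s : ℕ) (h : ℕ → ℝ) (hh : ∀ j, 0 ≤ h j) :
    ∑ i ∈ idx K l s, h i.2.1 ≤ 2 * 2 ^ l * ∑ j ∈ Finset.range (K + 1), h j := by
  unfold idx
  rw [Finset.sum_filter, Finset.sum_product]
  simp only [Finset.sum_product]
  rw [Finset.sum_comm, Finset.mul_sum]
  refine Finset.sum_le_sum fun j _ => ?_
  rw [Finset.sum_comm]
  have h1 : ∀ m ∈ Finset.range (2 ^ l), ∑ n ∈ Finset.range K,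
      (if l ≤ n ∧ (j - n) + (n - j) = s then h j else 0) ≤ 2 * h j := by
    intro m _
    rw [← Finset.sum_filter, Finset.sum_const, nsmul_eq_mul]
    refine mul_le_mul_of_nonneg_right ?_ (hh j)
    have : (Finset.filter (fun n => l ≤ n ∧ (j - n) + (n - j) = s) (Finset.range K)) ⊆ {j + s, j - s} := by
      intro n hn
      simp only [Finset.mem_filter, Finset.mem_insert, Finset.mem_singleton] at *
      omega
    exact_mod_cast (Finset.card_le_card this).trans Finset.card_le_two
  refine (Finset.sum_le_sum h1).trans (le_of_eq ?_)
  simp; ring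

section sym
variable {d : ℕ} (θ : Fin d → ℝ)

noncomputable def dl (K j : ℕ) : ℝ := if j < K then sF θ j - sF θ (j + 1) else sF θ K

lemma dl_nonneg (K j : ℕ) : 0 ≤ dl θ K j := by
  unfold dl; split_ifs
  · linarith [sF_succ_le θ j]
  · exact sF_nonneg _ _

lemma dl_sum (K : ℕ) : ∑ j ∈ Finset.range (K + 1), dl θ K j = 1 := by
  rw [Finset.sum_range_succ]
  have : ∑ j ∈ Finset.range K, dl θ K j = ∑ j ∈ Finset.range K, (sF θ j - sF θ (j + 1)) :=
    Finset.sum_congr rfl fun j hj => by simp [dl, Finset.mem_range.1 hj]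
  rw [this, Finset.sum_range_sub', sF_zero]
  simp [dl]

lemma dl_le (K j : ℕ) (hj : j ≤ K) : dl θ K j ≤ sF θ j := by
  unfold dl; split_ifs
  · linarith [sF_nonneg θ (j + 1)]
  · have : j = K := by omega
    rw [this]

lemma dl_le' (K j : ℕ) (hj : j < K) : dl θ K j ≤ 4 * 4 ^ j * sR θ := by
  unfold dl; rw [if_pos hj]
  have := sF_one_sub θ (j + 1)
  rw [pow_succ] at this
  linarith [sF_le_one θ j]

/-- second symbol -/
noncomputable def st1 (n l m : ℕ) : ℝ := sa θ (2 ^ n + m * 2 ^ (n - l))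
noncomputable def st2 (n l m : ℕ) : ℝ :=
  if l = 0 then sF θ (n + 1) else sa θ (2 ^ n + (m / 2) * 2 ^ (n - l + 1))

lemma good_a (n N : ℕ) (h1 : 2 ^ n ≤ N) (h2 : N ≤ 2 ^ (n + 1)) :
    |sa θ N| ≤ 1 ∧ |1 - sa θ N| ≤ 8 * 4 ^ n * sR θ ∧ sa θ N ^ 2 * (1 + 4 ^ n * sR θ) ≤ 1 := by
  have hR := sR_nonneg θ
  have e4 : ((2:ℝ) ^ n) ^ 2 = 4 ^ n := by rw [← pow_mul, mul_comm, pow_mul]; norm_num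
  have h1' : (2:ℝ) ^ n ≤ N := by exact_mod_cast h1
  have h2' : (N:ℝ) ≤ 2 ^ (n + 1) := by exact_mod_cast h2
  have h3 : (4:ℝ) ^ n ≤ (N:ℝ) ^ 2 := by rw [← e4]; gcongr
  have h4 : (N:ℝ) ^ 2 ≤ 4 * 4 ^ n := by
    calc (N:ℝ) ^ 2 ≤ (2 ^ (n + 1)) ^ 2 := by gcongr
      _ = _ := by rw [← e4]; ring
  refine ⟨sa_abs _ _, (sa_one_sub θ N).trans ?_, le_trans ?_ (sa_sq θ N)⟩
  · nlinarith [mul_le_mul_of_nonneg_right h4 hR]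
  · gcongr

lemma good_F (n : ℕ) :
    |sF θ (n + 1)| ≤ 1 ∧ |1 - sF θ (n + 1)| ≤ 8 * 4 ^ n * sR θ ∧
      sF θ (n + 1) ^ 2 * (1 + 4 ^ n * sR θ) ≤ 1 := by
  have hR := sR_nonneg θ
  have h0 := sF_nonneg θ (n + 1)
  have h1 := sF_le_one θ (n + 1)
  refine ⟨by rw [abs_of_nonneg h0]; exact h1, ?_, ?_⟩
  · rw [abs_of_nonneg (by linarith)]
    refine (sF_one_sub θ (n + 1)).trans ?_
    rw [pow_succ]
    have : 0 ≤ 4 ^ n * sR θ := by positivity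
    linarith
  · have := sF_decay θ (n + 1) (by omega)
    rw [pow_succ, mul_div_assoc, div_self (by norm_num), mul_one] at this
    refine le_trans (mul_le_mul_of_nonneg_right ?_ (by positivity)) this
    nlinarith

lemma idx_arith (n l m : ℕ) (hl : l ≤ n) (hm : m < 2 ^ l) :
    2 ^ n + m * 2 ^ (n - l) < 2 ^ (n + 1) ∧
    (l ≠ 0 → 2 ^ n + (m / 2) * 2 ^ (n - l + 1) + (m % 2) * 2 ^ (n - l) = 2 ^ n + m * 2 ^ (n - l)) := by
  constructor
  · have : m * 2 ^ (n - l) < 2 ^ l * 2 ^ (n - l) := Nat.mul_lt_mul_of_pos_right hm (by positivity)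
    rw [← pow_add, Nat.add_sub_cancel' hl] at this
    rw [pow_succ]; omega
  · intro _
    have h := Nat.div_add_mod m 2
    conv_rhs => rw [← h]
    rw [pow_succ]; ring

lemma st_good (n l m : ℕ) (hl : l ≤ n) (hm : m < 2 ^ l) :
    (|st1 θ n l m| ≤ 1 ∧ |1 - st1 θ n l m| ≤ 8 * 4 ^ n * sR θ ∧ st1 θ n l m ^ 2 * (1 + 4 ^ n * sR θ) ≤ 1) ∧
    (|st2 θ n l m| ≤ 1 ∧ |1 - st2 θ n l m| ≤ 8 * 4 ^ n * sR θ ∧ st2 θ n l m ^ 2 * (1 + 4 ^ n * sR θ) ≤ 1) := by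
  obtain ⟨h1, h2⟩ := idx_arith n l m hl hm
  refine ⟨good_a θ n _ (by omega) h1.le, ?_⟩
  unfold st2
  split_ifs with h
  · exact good_F θ n
  · exact good_a θ n _ (by omega) (by have := h2 h; omega)

lemma st_small (n l m : ℕ) (hl : l ≤ n) (hm : m < 2 ^ l) :
    (st1 θ n l m - st2 θ n l m) ^ 2 * 4 ^ l ≤ 14400 := by
  have e4 : ((2:ℝ) ^ l) ^ 2 = 4 ^ l := by rw [← pow_mul, mul_comm, pow_mul]; norm_num
  suffices h : |st1 θ n l m - st2 θ n l m| * 2 ^ l ≤ 120 by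
    rw [← e4, ← sq_abs, ← mul_pow]
    calc _ ≤ (120:ℝ) ^ 2 := by gcongr
      _ = _ := by norm_num
  obtain ⟨⟨a1, -, -⟩, ⟨a2, -, -⟩⟩ := st_good θ n l m hl hm
  by_cases h0 : l = 0
  · subst h0
    rw [abs_le] at a1 a2
    have : |st1 θ n 0 m - st2 θ n 0 m| ≤ 2 := by rw [abs_le]; constructor <;> linarith
    simpa using this.trans (by norm_num)
  · obtain ⟨-, h2⟩ := idx_arith n l m hl hm
    unfold st1 st2
    rw [if_neg h0, ← h2 h0]
    set N := 2 ^ n + (m / 2) * 2 ^ (n - l + 1) with hN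
    have hNn : 2 ^ n ≤ N := by omega
    have hN1 : 1 ≤ N := le_trans (Nat.one_le_two_pow) hNn
    have hs := sa_smooth θ N ((m % 2) * 2 ^ (n - l)) hN1
    have hN' : (2:ℝ) ^ n ≤ N := by exact_mod_cast hNn
    have hm2 : (((m % 2) * 2 ^ (n - l) : ℕ) : ℝ) ≤ 2 ^ (n - l) := by
      have : (m % 2) * 2 ^ (n - l) ≤ 1 * 2 ^ (n - l) := Nat.mul_le_mul_right _ (by omega)
      rw [one_mul] at this
      exact_mod_cast this
    have e : (2:ℝ) ^ n = 2 ^ (n - l) * 2 ^ l := by rw [← pow_add, Nat.sub_add_cancel hl]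
    calc _ ≤ (60 * (((m % 2) * 2 ^ (n - l) : ℕ) : ℝ) / N) * 2 ^ l := by gcongr
      _ ≤ (60 * 2 ^ (n - l) / 2 ^ n) * 2 ^ l := by gcongr
      _ = 60 := by rw [e]; field_simp
      _ ≤ 120 := by norm_num

lemma st_off (K n l m j s : ℕ) (hl : l ≤ n) (hm : m < 2 ^ l) (hn : n < K) (hj : j ≤ K)
    (hs : (j - n) + (n - j) = s) :
    (st1 θ n l m - st2 θ n l m) ^ 2 * dl θ K j * 4 ^ s ≤ 128 := by
  obtain ⟨⟨a1, b1, c1⟩, ⟨a2, b2, c2⟩⟩ := st_good θ n l m hl hm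
  set z := st1 θ n l m
  set z' := st2 θ n l m
  set ρ := sR θ
  have hR : 0 ≤ ρ := sR_nonneg θ
  have ht : |z - z'| ≤ 2 := by rw [abs_le] at *; constructor <;> linarith
  have ht2 : |z - z'| ≤ 16 * 4 ^ n * ρ := by rw [abs_le] at *; constructor <;> linarith
  have ht3 : (z - z') ^ 2 * (1 + 4 ^ n * ρ) ≤ 4 := by
    have : (z - z') ^ 2 ≤ 2 * z ^ 2 + 2 * z' ^ 2 := by nlinarith [sq_nonneg (z + z')]
    have := mul_le_mul_of_nonneg_right this (show 0 ≤ 1 + 4 ^ n * ρ by positivity)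
    nlinarith
  have d0 := dl_nonneg θ K j
  have d1 := dl_le θ K j hj
  have hF1 := sF_le_one θ j
  rcases lt_trichotomy j n with h | h | h
  · have d2 := dl_le' θ K j (by omega)
    have e : (4:ℝ) ^ n = 4 ^ j * 4 ^ s := by rw [← pow_add]; congr 1; omega
    have h1 : (z - z') ^ 2 * (4 ^ n * ρ) ≤ 4 := by nlinarith [sq_nonneg (z - z')]
    calc _ ≤ (z - z') ^ 2 * (4 * 4 ^ j * ρ) * 4 ^ s := by gcongr
      _ = 4 * ((z - z') ^ 2 * (4 ^ n * ρ)) := by rw [e]; ring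
      _ ≤ 128 := by linarith
  · have : s = 0 := by omega
    subst this
    rw [pow_zero, mul_one]
    have : (z - z') ^ 2 ≤ 4 := by rw [← sq_abs]; nlinarith [abs_nonneg (z - z')]
    nlinarith [sq_nonneg (z - z')]
  · have e : (4:ℝ) ^ j = 4 ^ n * 4 ^ s := by rw [← pow_add]; congr 1; omega
    have hd := sF_decay θ j (by omega)
    have h2 : sF θ j * (4 ^ j * ρ) ≤ 4 := by
      have := sF_nonneg θ j
      nlinarith
    have h1 : (z - z') ^ 2 ≤ 32 * 4 ^ n * ρ := by
      rw [← sq_abs]; nlinarith [abs_nonneg (z - z')]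
    calc _ ≤ (32 * 4 ^ n * ρ) * sF θ j * 4 ^ s := by gcongr
      _ = 32 * (sF θ j * (4 ^ j * ρ)) := by rw [e]; ring
      _ ≤ 128 := by linarith

lemma sym_sum (K l s : ℕ) :
    ∑ i ∈ idx K l s, (st1 θ i.1 l i.2.2 - st2 θ i.1 l i.2.2) ^ 2 * dl θ K i.2.1 ^ 2 ≤
      28800 * min ((2:ℝ) ^ l)⁻¹ (2 ^ l * (4 ^ s)⁻¹) := by
  have hX : ∀ X : ℝ, 0 ≤ X → (∀ i ∈ idx K l s, (st1 θ i.1 l i.2.2 - st2 θ i.1 l i.2.2) ^ 2 * dl θ K i.2.1 ≤ X) →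
      ∑ i ∈ idx K l s, (st1 θ i.1 l i.2.2 - st2 θ i.1 l i.2.2) ^ 2 * dl θ K i.2.1 ^ 2 ≤ 2 * 2 ^ l * X := by
    intro X hX0 hX
    calc _ ≤ ∑ i ∈ idx K l s, X * dl θ K i.2.1 := by
          refine Finset.sum_le_sum fun i hi => ?_
          have := mul_le_mul_of_nonneg_right (hX i hi) (dl_nonneg θ K i.2.1)
          calc _ = _ := ?_
            _ ≤ _ := this
          ring
      _ ≤ 2 * 2 ^ l * ∑ j ∈ Finset.range (K + 1), X * dl θ K j :=
          idx_sum K l s (fun j => X * dl θ K j) fun j => mul_nonneg hX0 (dl_nonneg _ _ _)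
      _ = _ := by rw [← Finset.mul_sum, dl_sum, mul_one]
  have hmem : ∀ i ∈ idx K l s, i.1 < K ∧ i.2.1 ≤ K ∧ i.2.2 < 2 ^ l ∧ l ≤ i.1 ∧
      (i.2.1 - i.1) + (i.1 - i.2.1) = s := by
    intro i hi
    simp only [idx, Finset.mem_filter, Finset.mem_product, Finset.mem_range] at hi
    omega
  have e4 : (4:ℝ) ^ l = 2 ^ l * 2 ^ l := by rw [← mul_pow]; norm_num
  rw [mul_min_of_nonneg _ _ (by norm_num)]
  refine le_min ?_ ?_
  · refine (hX (14400 * (4 ^ l)⁻¹) (by positivity) ?_).trans (le_of_eq ?_)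
    · intro i hi
      obtain ⟨h1, h2, h3, h4, h5⟩ := hmem i hi
      have a := st_small θ i.1 l i.2.2 h4 h3
      rw [← le_div_iff₀ (by positivity), div_eq_mul_inv] at a
      refine le_trans (mul_le_of_le_one_right (sq_nonneg _) ?_) a
      exact (dl_le θ K _ h2).trans (sF_le_one _ _)
    · rw [e4]; field_simp; norm_num
  · refine (hX (128 * (4 ^ s)⁻¹) (by positivity) ?_).trans ?_
    · intro i hi
      obtain ⟨h1, h2, h3, h4, h5⟩ := hmem i hi
      have a := st_off θ K i.1 l i.2.2 i.2.1 s h4 h3 h1 h2 h5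
      rwa [← le_div_iff₀ (by positivity), div_eq_mul_inv] at a
    · have : (0:ℝ) ≤ 2 ^ l * (4 ^ s)⁻¹ := by positivity
      linarith
end sym


section kern
variable {G : Type} [Fintype G] [AddCommGroup G]

open Classical in
noncomputable def ker {A : Type*} (s : Finset A) (v : A → G) (y : G) : ℝ :=
  (∑ a ∈ s, if v a = y then 1 else 0) / s.card

lemma ker_sum {A : Type*} (s : Finset A) (v : A → G) (g : G → ℝ) :
    ∑ y, ker s v y * g y = (∑ a ∈ s, g (v a)) / s.card := by
  classical
  unfold ker
  simp only [div_mul_eq_mul_div, ← Finset.sum_div, Finset.sum_mul]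
  rw [Finset.sum_comm]
  simp

lemma ker_sum' {A : Type*} (s : Finset A) (v : A → G) (g : G → ℂ) :
    ∑ y, (ker s v y : ℂ) * g y = (∑ a ∈ s, g (v a)) / s.card := by
  classical
  unfold ker
  push_cast
  simp only [div_mul_eq_mul_div, ← Finset.sum_div, Finset.sum_mul]
  rw [Finset.sum_comm]
  congr 1
  refine Finset.sum_congr rfl fun a _ => ?_
  rw [Finset.sum_eq_single (v a)]
  · rw [if_pos rfl, Complex.ofReal_one, one_mul]
  · intro y _ hy; rw [if_neg hy.symm, Complex.ofReal_zero, zero_mul]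
  · intro h; exact absurd (Finset.mem_univ _) h

lemma ker_prob {A : Type*} (s : Finset A) (hs : s.Nonempty) (v : A → G) : IsProb (ker s v) := by
  classical
  constructor
  · intro y
    unfold ker
    refine div_nonneg (Finset.sum_nonneg fun a _ => ?_) (Nat.cast_nonneg _)
    split_ifs <;> norm_num
  · have := ker_sum s v (fun _ => 1)
    simp only [mul_one, Finset.sum_const, nsmul_eq_mul] at this
    rw [this, div_self]
    exact_mod_cast hs.card_pos.ne'

lemma cv_ker {A : Type*} (s : Finset A) (v : A → G) (f : G → ℝ) (x : G) :
    cv (ker s v) f x = (∑ a ∈ s, f (x - v a)) / s.card := ker_sum s v fun y => f (x - y)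

lemma ft_ker {A : Type*} (s : Finset A) (v : A → G) (ψ : AddChar G ℂ) :
    ft (ker s v) ψ = (∑ a ∈ s, ψ (v a)) / s.card := ker_sum' s v ψ

variable {d : ℕ} (ι : (Fin d → ℤ) →+ G)

noncomputable def box (d N : ℕ) : Finset (Fin d → ℤ) := Finset.Icc (fun _ => -(N:ℤ)) (fun _ => (N:ℤ))

noncomputable def kA (N : ℕ) : G → ℝ := ker (box d N) ι

abbrev Bt (d K : ℕ) := Fin d × Fin K → Bool

def uu {K : ℕ} (n : ℕ) (b : Bt d K) (i : Fin d) : ℤ :=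
  ∑ k : Fin K, if (k:ℕ) < n ∧ b (i, k) = true then 2 ^ (k:ℕ) else 0

noncomputable def kS (K n : ℕ) : G → ℝ :=
  ker (Finset.univ : Finset (Bt d K × Bt d K)) (fun bc => ι (uu n bc.1 - uu n bc.2))

lemma kA_prob (N : ℕ) : IsProb (kA ι N) := by
  apply ker_prob
  rw [box, Finset.nonempty_Icc]
  intro i; simp

lemma kS_prob (K n : ℕ) : IsProb (kS ι K n) := ker_prob _ Finset.univ_nonempty _

noncomputable def kD (K j : ℕ) : G → ℝ := if j < K then kS ι K j - kS ι K (j + 1) else kS ι K K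

lemma addChar_sum {I : Type*} (s : Finset I) (ψ : AddChar G ℂ) (g : I → G) :
    ψ (∑ i ∈ s, g i) = ∏ i ∈ s, ψ (g i) := by
  classical
  induction s using Finset.induction_on with
  | empty => simp
  | insert a s ha ih => rw [Finset.sum_insert ha, Finset.prod_insert ha, AddChar.map_add_eq_mul, ih]

lemma exists_theta (ψ : AddChar G ℂ) : ∃ θ : Fin d → ℝ, ∀ y : Fin d → ℤ,
    ψ (ι y) = ∏ i, Complex.exp (((2 * θ i * y i : ℝ) : ℂ) * Complex.I) := by
  refine ⟨fun i => Complex.arg (ψ (ι (Pi.single i 1))) / 2, fun y => ?_⟩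
  have hy : y = ∑ i, y i • (Pi.single i 1 : Fin d → ℤ) := by
    funext j
    simp [Finset.sum_apply, Pi.single_apply]
  conv_lhs => rw [hy]
  rw [map_sum, addChar_sum]
  refine Finset.prod_congr rfl fun i _ => ?_
  rw [map_zsmul, AddChar.map_zsmul_eq_zpow]
  have h := Complex.norm_mul_exp_arg_mul_I (ψ (ι (Pi.single i 1)))
  rw [AddChar.norm_apply, Complex.ofReal_one, one_mul] at h
  conv_lhs => rw [← h]
  rw [← Complex.exp_int_mul]
  congr 1
  push_cast
  ring

lemma sum_Icc_exp (N : ℕ) (t : ℝ) :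
    ∑ y ∈ Finset.Icc (-(N:ℤ)) N, Complex.exp (((2 * t * y : ℝ) : ℂ) * Complex.I) =
      (((2 * N + 1) * Dk N t : ℝ) : ℂ) := by
  have h0 : (2 * (N:ℝ) + 1) ≠ 0 := by positivity
  unfold Dk
  rw [mul_div_cancel₀ _ h0]
  clear h0
  induction N with
  | zero => simp
  | succ N ih =>
    have e : Finset.Icc (-((N + 1 : ℕ):ℤ)) ((N + 1 : ℕ):ℤ) =
        insert ((N:ℤ) + 1) (insert (-(N:ℤ) - 1) (Finset.Icc (-(N:ℤ)) N)) := by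
      ext z; simp only [Finset.mem_Icc, Finset.mem_insert]; push_cast; omega
    rw [e, Finset.sum_insert, Finset.sum_insert, ih, Finset.sum_range_succ]
    · have h := Complex.two_cos (((2 * (N + 1) * t : ℝ)) : ℂ)
      push_cast at h ⊢
      have e1 : (2:ℂ) * t * (N + 1) * Complex.I = 2 * (N + 1) * t * Complex.I := by ring
      have e2 : (2:ℂ) * t * (-N - 1) * Complex.I = -(2 * (N + 1) * t) * Complex.I := by ring
      rw [e1, e2]
      linear_combination -h
    · simp
    · simp only [Finset.mem_insert, Finset.mem_Icc]; omega

lemma ft_kA (ψ : AddChar G ℂ) (θ : Fin d → ℝ)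
    (hθ : ∀ y : Fin d → ℤ, ψ (ι y) = ∏ i, Complex.exp (((2 * θ i * y i : ℝ) : ℂ) * Complex.I))
    (N : ℕ) : ft (kA ι N) ψ = (sa θ N : ℂ) := by
  unfold kA
  rw [ft_ker]
  simp only [hθ]
  have hc : ((box d N).card : ℂ) = ∏ i : Fin d, (2 * (N:ℂ) + 1) := by
    unfold box
    rw [Pi.card_Icc]
    push_cast
    refine Finset.prod_congr rfl fun i _ => ?_
    rw [Int.card_Icc]
    have : ((N:ℤ) + 1 - -(N:ℤ)).toNat = 2 * N + 1 := by omega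
    rw [this]; push_cast; ring
  rw [hc, box, Pi.Icc_eq]
  rw [← Finset.prod_univ_sum (fun _ => Finset.Icc (-(N:ℤ)) N)
    (fun i y => Complex.exp (((2 * θ i * y : ℝ) : ℂ) * Complex.I))]
  rw [← Finset.prod_div_distrib]
  unfold sa
  push_cast
  refine Finset.prod_congr rfl fun i _ => ?_
  have := sum_Icc_exp N (θ i)
  push_cast at this
  rw [this, mul_div_cancel_left₀]
  have : (2 * (N:ℝ) + 1) ≠ 0 := by positivity
  exact_mod_cast this

lemma norm_one_add_exp (t : ℝ) : ‖1 + Complex.exp (((2 * t : ℝ) : ℂ) * Complex.I)‖ ^ 2 = 4 * Real.cos t ^ 2 := by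
  have : 1 + Complex.exp (((2 * t : ℝ) : ℂ) * Complex.I) =
      ((2 * Real.cos t : ℝ) : ℂ) * Complex.exp ((t:ℂ) * Complex.I) := by
    push_cast
    rw [Complex.two_cos, add_mul, ← Complex.exp_add, ← Complex.exp_add]
    rw [show (t:ℂ) * Complex.I + t * Complex.I = 2 * t * Complex.I by ring,
      show -(t:ℂ) * Complex.I + t * Complex.I = 0 by ring, Complex.exp_zero, add_comm]
  rw [this, norm_mul, Complex.norm_exp_ofReal_mul_I, mul_one, Complex.norm_real, Real.norm_eq_abs, sq_abs]
  ring

lemma ft_kS (ψ : AddChar G ℂ) (θ : Fin d → ℝ)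
    (hθ : ∀ y : Fin d → ℤ, ψ (ι y) = ∏ i, Complex.exp (((2 * θ i * y i : ℝ) : ℂ) * Complex.I))
    (K n : ℕ) (hn : n ≤ K) : ft (kS ι K n) ψ = (sF θ n : ℂ) := by
  unfold kS
  rw [ft_ker]
  have h1 : ∀ b : Bt d K, ψ (ι (uu n b)) = ∏ q : Fin d × Fin K,
      (fun (q : Fin d × Fin K) (β : Bool) => if (q.2:ℕ) < n ∧ β = true then
        Complex.exp (((2 * (2 ^ (q.2:ℕ) * θ q.1) : ℝ) : ℂ) * Complex.I) else 1) q (b q) := by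
    intro b
    rw [hθ, Fintype.prod_prod_type]
    refine Finset.prod_congr rfl fun i _ => ?_
    unfold uu
    push_cast
    rw [Finset.mul_sum, Finset.sum_mul, Complex.exp_sum]
    refine Finset.prod_congr rfl fun k _ => ?_
    split_ifs
    · congr 1; push_cast; ring
    · simp
  have hS : ∑ b : Bt d K, ψ (ι (uu n b)) = ∏ q : Fin d × Fin K,
      (if (q.2:ℕ) < n then 1 + Complex.exp (((2 * (2 ^ (q.2:ℕ) * θ q.1) : ℝ) : ℂ) * Complex.I) else 2) := by
    simp only [h1]
    have := Finset.prod_univ_sum (fun _ : Fin d × Fin K => (Finset.univ : Finset Bool))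
      (fun (q : Fin d × Fin K) (β : Bool) => if (q.2:ℕ) < n ∧ β = true then
        Complex.exp (((2 * (2 ^ (q.2:ℕ) * θ q.1) : ℝ) : ℂ) * Complex.I) else 1)
    rw [Fintype.piFinset_univ] at this
    rw [← this]
    refine Finset.prod_congr rfl fun q _ => ?_
    rw [Fintype.sum_bool]
    by_cases hq : (q.2:ℕ) < n
    · simp [hq]; ring
    · simp [hq]; norm_num
  have h2 : ∑ bc : Bt d K × Bt d K, ψ (ι (uu n bc.1 - uu n bc.2)) =
      ((‖∑ b : Bt d K, ψ (ι (uu n b))‖ ^ 2 : ℝ) : ℂ) := by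
    push_cast
    rw [← Complex.mul_conj', map_sum, Finset.sum_mul_sum, Fintype.sum_prod_type]
    refine Finset.sum_congr rfl fun b _ => Finset.sum_congr rfl fun c _ => ?_
    rw [map_sub, sub_eq_add_neg, AddChar.map_add_eq_mul, AddChar.map_neg_eq_conj]
  rw [h2, hS]
  have hc : ((Finset.univ : Finset (Bt d K × Bt d K)).card : ℝ) = ∏ q : Fin d × Fin K, (4:ℝ) := by
    rw [Finset.card_univ, Fintype.card_prod, Fintype.card_fun]
    simp only [Fintype.card_bool, Finset.prod_const, Finset.card_univ]
    push_cast
    rw [← mul_pow]; norm_num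
  have e : ((Finset.univ : Finset (Bt d K × Bt d K)).card : ℂ) =
    (((Finset.univ : Finset (Bt d K × Bt d K)).card : ℝ) : ℂ) := by push_cast; rfl
  rw [e, ← Complex.ofReal_div]
  congr 1
  rw [hc, norm_prod, ← Finset.prod_pow, ← Finset.prod_div_distrib, Fintype.prod_prod_type]
  unfold sF gk
  refine Finset.prod_congr rfl fun i _ => ?_
  have : ∀ k : Fin K, ‖(if (k:ℕ) < n then 1 + Complex.exp (((2 * (2 ^ (k:ℕ) * θ i) : ℝ) : ℂ) * Complex.I)
      else 2)‖ ^ 2 / 4 = if (k:ℕ) < n then Real.cos (2 ^ (k:ℕ) * θ i) ^ 2 else 1 := by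
    intro k
    split_ifs
    · rw [norm_one_add_exp]; ring
    · norm_num
  simp only [this]
  rw [← Finset.prod_range (fun k => if k < n then Real.cos (2 ^ k * θ i) ^ 2 else 1)]
  rw [← Finset.prod_filter]
  congr 1
  ext k; simp only [Finset.mem_filter, Finset.mem_range]; omega

lemma ft_kD (ψ : AddChar G ℂ) (θ : Fin d → ℝ)
    (hθ : ∀ y : Fin d → ℤ, ψ (ι y) = ∏ i, Complex.exp (((2 * θ i * y i : ℝ) : ℂ) * Complex.I))
    (K j : ℕ) (hj : j ≤ K) : ft (kD ι K j) ψ = (dl θ K j : ℂ) := by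
  unfold kD dl
  split_ifs with h
  · rw [ft_sub, ft_kS ι ψ θ hθ K j hj, ft_kS ι ψ θ hθ K (j + 1) h]; push_cast; rfl
  · exact ft_kS ι ψ θ hθ K K le_rfl

/-- the two kernels -/
noncomputable def k1 (n l m : ℕ) : G → ℝ := kA ι (2 ^ n + m * 2 ^ (n - l))
noncomputable def k2 (K n l m : ℕ) : G → ℝ :=
  if l = 0 then kS ι K (n + 1) else kA ι (2 ^ n + (m / 2) * 2 ^ (n - l + 1))

lemma k1_prob (n l m : ℕ) : IsProb (k1 ι n l m) := kA_prob _ _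
lemma k2_prob (K n l m : ℕ) : IsProb (k2 ι K n l m) := by
  unfold k2; split_ifs
  · exact kS_prob _ _ _
  · exact kA_prob _ _

noncomputable def QQ (K l s : ℕ) (f : G → ℝ) (x : G) : ℝ :=
  √(∑ i ∈ idx K l s, (cv (k1 ι i.1 l i.2.2 - k2 ι K i.1 l i.2.2) (cv (kD ι K i.2.1) f) x) ^ 2)

lemma idx_mem {K l s : ℕ} {i : ℕ × ℕ × ℕ} (hi : i ∈ idx K l s) :
    i.1 < K ∧ i.2.1 ≤ K ∧ i.2.2 < 2 ^ l ∧ l ≤ i.1 ∧ (i.2.1 - i.1) + (i.1 - i.2.1) = s := by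
  simp only [idx, Finset.mem_filter, Finset.mem_product, Finset.mem_range] at hi
  omega

lemma QQ_L2 (K l s : ℕ) (f : G → ℝ) :
    ∑ x, QQ ι K l s f x ^ (2:ℝ) ≤
      28800 * min ((2:ℝ) ^ l)⁻¹ (2 ^ l * (4 ^ s)⁻¹) * ∑ x, f x ^ (2:ℝ) := by
  unfold QQ
  have : ∀ x, √(∑ i ∈ idx K l s, (cv (k1 ι i.1 l i.2.2 - k2 ι K i.1 l i.2.2) (cv (kD ι K i.2.1) f) x) ^ 2) ^ (2:ℝ)
      = ∑ i ∈ idx K l s, (cv (k1 ι i.1 l i.2.2 - k2 ι K i.1 l i.2.2) (cv (kD ι K i.2.1) f) x) ^ 2 := by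
    intro x
    rw [Real.rpow_two, Real.sq_sqrt (Finset.sum_nonneg fun _ _ => sq_nonneg _)]
  simp only [this, Real.rpow_two]
  refine l2bound (idx K l s) (fun i => k1 ι i.1 l i.2.2 - k2 ι K i.1 l i.2.2)
    (fun i => kD ι K i.2.1) _ ?_ f
  intro ψ
  obtain ⟨θ, hθ⟩ := exists_theta ι ψ
  refine le_trans (le_of_eq ?_) (sym_sum θ K l s)
  refine Finset.sum_congr rfl fun i hi => ?_
  obtain ⟨h1, h2, h3, h4, h5⟩ := idx_mem hi
  have e1 : ft (k1 ι i.1 l i.2.2 - k2 ι K i.1 l i.2.2) ψ =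
      ((st1 θ i.1 l i.2.2 - st2 θ i.1 l i.2.2 : ℝ) : ℂ) := by
    rw [ft_sub]
    unfold k1 k2 st1 st2
    rw [ft_kA ι ψ θ hθ]
    split_ifs
    · rw [ft_kS ι ψ θ hθ K _ (by omega)]; push_cast; rfl
    · rw [ft_kA ι ψ θ hθ]; push_cast; rfl
  rw [e1, ft_kD ι ψ θ hθ K _ h2, Complex.norm_real, Complex.norm_real, Real.norm_eq_abs,
    Real.norm_eq_abs, sq_abs, sq_abs]

lemma QQ_nonneg (K l s : ℕ) (f : G → ℝ) (x : G) : 0 ≤ QQ ι K l s f x := Real.sqrt_nonneg _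

lemma sqrt_sum_add {I : Type*} (s : Finset I) (a b : I → ℝ) :
    √(∑ i ∈ s, (a i + b i) ^ 2) ≤ √(∑ i ∈ s, a i ^ 2) + √(∑ i ∈ s, b i ^ 2) := by
  have h := Real.Lp_add_le s a b (p := 2) (by norm_num)
  simp only [Real.rpow_two, sq_abs, ← Real.sqrt_eq_rpow] at h
  exact h

lemma QQ_add (K l s : ℕ) (f g : G → ℝ) (x : G) :
    QQ ι K l s (f + g) x ≤ QQ ι K l s f x + QQ ι K l s g x := by
  unfold QQ
  simp only [cv_add, Pi.add_apply]
  exact sqrt_sum_add _ _ _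

end kern


section lp
variable {G : Type} [Fintype G] [AddCommGroup G] {d : ℕ} (ι : (Fin d → ℤ) →+ G)

noncomputable def FF {K : ℕ} (n : ℕ) (f : G → ℝ) (X : G × Bt d K) : ℝ :=
  (∑ c : Bt d K, f (X.1 - ι (uu n X.2) + ι (uu n c))) / Fintype.card (Bt d K)

def RR {K : ℕ} (n : ℕ) (X Y : G × Bt d K) : Prop :=
  X.1 - ι (uu n X.2) = Y.1 - ι (uu n Y.2) ∧ ∀ q, n ≤ (q.2:ℕ) → X.2 q = Y.2 q

def mix {K : ℕ} (n : ℕ) (b c : Bt d K) : Bt d K := fun q => if (q.2:ℕ) < n then c q else b q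

lemma uu_mix {K : ℕ} (n : ℕ) (b c : Bt d K) : uu n (mix n b c) = uu n c := by
  funext i
  unfold uu mix
  refine Finset.sum_congr rfl fun k _ => ?_
  by_cases h : (k:ℕ) < n <;> simp [h]

lemma card_Bt_pos (K : ℕ) : (0:ℝ) < Fintype.card (Bt d K) := by exact_mod_cast Fintype.card_pos

lemma FF_mart {K : ℕ} (n : ℕ) (f : G → ℝ) (h : G × Bt d K → ℝ)
    (hh : ∀ X Y, RR ι n X Y → h X = h Y) :
    ∑ X, h X * FF ι n f X = ∑ X, h X * f X.1 := by
  have hB := card_Bt_pos (d := d) K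
  have e1 : ∑ X, h X * FF ι n f X = (∑ b : Bt d K, ∑ c : Bt d K, ∑ y : G, h (y, mix n b c) * f y) /
      Fintype.card (Bt d K) := by
    unfold FF
    rw [Fintype.sum_prod_type, Finset.sum_comm]
    simp only [← mul_div_assoc, ← Finset.sum_div, Finset.mul_sum]
    congr 1
    refine Finset.sum_congr rfl fun b _ => ?_
    rw [Finset.sum_comm]
    refine Finset.sum_congr rfl fun c _ => ?_
    refine Eq.trans (Finset.sum_congr rfl fun x _ => ?_)
      (Equiv.sum_comp (Equiv.addRight (- ι (uu n b) + ι (uu n c)))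
        (fun y => h (y, mix n b c) * f y))
    simp only [Equiv.coe_addRight]
    have : h (x, b) = h (x + (-ι (uu n b) + ι (uu n c)), mix n b c) := by
      apply hh
      refine ⟨?_, ?_⟩
      · simp only [uu_mix]; abel
      · intro q hq
        simp only [mix]; rw [if_neg (by omega)]
    rw [this]
    congr 2
    abel
  rw [e1, div_eq_iff hB.ne']
  have e2 : ∀ g : Bt d K → ℝ, ∑ b : Bt d K, ∑ c : Bt d K, g (mix n b c) =
      Fintype.card (Bt d K) * ∑ b, g b := by
    intro g
    have hinv : Function.Involutive (fun bc : Bt d K × Bt d K => (mix n bc.1 bc.2, mix n bc.2 bc.1)) := by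
      intro bc
      ext q <;> simp only [mix] <;> by_cases hq : (q.2:ℕ) < n <;> simp [hq]
    have := Equiv.sum_comp hinv.toPerm (fun bc : Bt d K × Bt d K => g bc.1)
    rw [Fintype.sum_prod_type, Fintype.sum_prod_type] at this
    simp only [Function.Involutive.coe_toPerm] at this
    rw [this]
    simp only [Finset.sum_const, Finset.card_univ, nsmul_eq_mul]
    rw [Finset.mul_sum]
  have e3 : ∑ b : Bt d K, ∑ c : Bt d K, ∑ y : G, h (y, mix n b c) * f y =
      Fintype.card (Bt d K) * ∑ b : Bt d K, ∑ y : G, h (y, b) * f y :=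
    e2 (fun b => ∑ y : G, h (y, b) * f y)
  rw [e3, Fintype.sum_prod_type, Finset.sum_comm, mul_comm]

lemma FF_meas {K : ℕ} (n : ℕ) (f : G → ℝ) (X Y : G × Bt d K) (h : RR ι n X Y) :
    FF ι n f X = FF ι n f Y := by
  unfold FF; rw [h.1]

lemma FF_zero {K : ℕ} (f : G → ℝ) (X : G × Bt d K) : FF ι 0 f X = f X.1 := by
  have hB := card_Bt_pos (d := d) K
  have : ∀ b : Bt d K, uu 0 b = 0 := by intro b; funext i; simp [uu]
  unfold FF
  simp only [this, map_zero, sub_zero, add_zero, Finset.sum_const, Finset.card_univ, nsmul_eq_mul]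
  field_simp

lemma FF_nonneg {K : ℕ} (n : ℕ) (f : G → ℝ) (hf : ∀ x, 0 ≤ f x) (X : G × Bt d K) : 0 ≤ FF ι n f X :=
  div_nonneg (Finset.sum_nonneg fun _ _ => hf _) (Nat.cast_nonneg _)

lemma RR_succ {K : ℕ} (n : ℕ) (X Y : G × Bt d K) (h : RR ι n X Y) : RR ι (n + 1) X Y := by
  have hu : ∀ b : Bt d K, uu (n + 1) b = uu n b +
      fun i => ∑ k : Fin K, if (k:ℕ) = n ∧ b (i, k) = true then 2 ^ (k:ℕ) else 0 := by
    intro b; funext i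
    simp only [uu, Pi.add_apply]
    rw [← Finset.sum_add_distrib]
    refine Finset.sum_congr rfl fun k _ => ?_
    by_cases hb : b (i, k) = true
    · rcases lt_trichotomy (k:ℕ) n with h | h | h
      · simp [hb, h, h.ne, h.trans (Nat.lt_succ_self n)]
      · simp [hb, h]
      · have h1 : ¬ (k:ℕ) < n := by omega
        have h2 : ¬ (k:ℕ) < n + 1 := by omega
        simp [h1, h2, h.ne']
    · simp [hb]
  refine ⟨?_, fun q hq => h.2 q (by omega)⟩
  rw [hu, hu, map_add, map_add, ← sub_sub, ← sub_sub, h.1]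
  congr 2
  funext i
  refine Finset.sum_congr rfl fun k _ => ?_
  by_cases hk : (k:ℕ) = n
  · rw [h.2 (i, k) (by simp [hk])]
  · simp [hk]

lemma avg_FF {K : ℕ} (n : ℕ) (f : G → ℝ) (x : G) :
    (∑ b : Bt d K, FF ι n f (x, b)) / Fintype.card (Bt d K) = cv (kS ι K n) f x := by
  unfold kS FF
  rw [cv_ker, ← Finset.sum_div, div_div, Fintype.sum_prod_type, Finset.card_univ, Fintype.card_prod]
  push_cast
  congr 1
  refine Finset.sum_congr rfl fun b _ => Finset.sum_congr rfl fun c _ => ?_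
  simp only [map_sub]
  congr 1
  abel

noncomputable def mm (K : ℕ) (f : G → ℝ) : G × Bt d K → ℝ := runMax (fun i => FF ι (K - i) f) K

lemma le_mm {K n : ℕ} (hn : n ≤ K) (f : G → ℝ) (X : G × Bt d K) : FF ι n f X ≤ mm ι K f X := by
  have := le_runMax (fun i => FF (K := K) ι (K - i) f) K (K - n) (by omega) X
  rwa [show K - (K - n) = n by omega] at this

lemma mm_nonneg {K : ℕ} (f : G → ℝ) (hf : ∀ x, 0 ≤ f x) (X : G × Bt d K) : 0 ≤ mm ι K f X :=
  (FF_nonneg ι 0 f hf X).trans (le_mm ι (by omega) f X)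

lemma mart_hyps (K : ℕ) (f : G → ℝ) :
    (∀ i (x y : G × Bt d K), RR ι (K - (i + 1)) x y → RR ι (K - i) x y) ∧
    (∀ i ≤ K, ∀ x y : G × Bt d K, RR ι (K - i) x y → FF ι (K - i) f x = FF ι (K - i) f y) ∧
    (∀ i ≤ K, ∀ h : G × Bt d K → ℝ, (∀ x y, RR ι (K - i) x y → h x = h y) →
      ∑ x, h x * FF ι (K - i) f x = ∑ x, h x * FF ι (K - K) f x) := by
  refine ⟨?_, ?_, ?_⟩
  · intro i x y h
    rcases Nat.lt_or_ge i K with hi | hi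
    · have := RR_succ ι _ x y h
      rwa [show K - (i + 1) + 1 = K - i by omega] at this
    · rwa [show K - (i + 1) = K - i by omega] at h
  · intro i _ x y h; exact FF_meas ι _ f x y h
  · intro i _ h hh
    rw [FF_mart ι _ f h hh]
    simp only [Nat.sub_self, FF_zero]

lemma mm_doob (r : ℝ) (hr : 1 < r) (K : ℕ) (f : G → ℝ) (hf : ∀ x, 0 ≤ f x) :
    ∑ X : G × Bt d K, mm ι K f X ^ r ≤ (r / (r - 1)) ^ r * (Fintype.card (Bt d K) * ∑ x, f x ^ r) := by
  obtain ⟨h1, h2, h3⟩ := mart_hyps ι K f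
  have := doob r hr K (fun i => FF (K := K) ι (K - i) f) (fun i => RR ι (K - i))
    (fun i x => FF_nonneg ι _ f hf x) h1 h2 h3
  refine this.trans (le_of_eq ?_)
  simp only [Nat.sub_self, FF_zero]
  rw [Fintype.sum_prod_type]
  simp only [Finset.sum_const, Finset.card_univ, nsmul_eq_mul, Finset.mul_sum]

lemma avg_rpow {A : Type*} [Fintype A] [Nonempty A] (g : A → ℝ) (hg : ∀ a, 0 ≤ g a) (p : ℝ) (hp : 1 ≤ p) :
    ((∑ a, g a) / Fintype.card A) ^ p ≤ (∑ a, g a ^ p) / Fintype.card A := by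
  have hc : (0:ℝ) < Fintype.card A := by exact_mod_cast Fintype.card_pos
  have := Real.rpow_arith_mean_le_arith_mean_rpow Finset.univ (fun _ : A => (1:ℝ) / Fintype.card A) g
    (fun _ _ => by positivity) (by simp) (fun a _ => hg a) hp
  rw [← Finset.mul_sum, ← Finset.mul_sum, one_div_mul_eq_div, one_div_mul_eq_div] at this
  exact this

lemma Sstar (p : ℝ) (hp : 1 < p) (K : ℕ) (f : G → ℝ) (hf : ∀ x, 0 ≤ f x) :
    ∃ m : G → ℝ, (∀ x, 0 ≤ m x) ∧ (∀ n ≤ K, ∀ x, cv (kS ι K n) f x ≤ m x) ∧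
      ∑ x, m x ^ p ≤ (p / (p - 1)) ^ p * ∑ x, f x ^ p := by
  have hB := card_Bt_pos (d := d) K
  refine ⟨fun x => (∑ b : Bt d K, mm ι K f (x, b)) / Fintype.card (Bt d K), ?_, ?_, ?_⟩
  · intro x; exact div_nonneg (Finset.sum_nonneg fun _ _ => mm_nonneg ι f hf _) hB.le
  · intro n hn x
    rw [← avg_FF]
    exact div_le_div_of_nonneg_right (Finset.sum_le_sum fun b _ => le_mm ι hn f _) hB.le
  · calc _ ≤ ∑ x, (∑ b : Bt d K, mm ι K f (x, b) ^ p) / Fintype.card (Bt d K) :=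
          Finset.sum_le_sum fun x _ => avg_rpow _ (fun b => mm_nonneg ι f hf _) p hp.le
      _ = (∑ X : G × Bt d K, mm ι K f X ^ p) / Fintype.card (Bt d K) := by
          rw [← Finset.sum_div, Fintype.sum_prod_type]
      _ ≤ ((p / (p - 1)) ^ p * (Fintype.card (Bt d K) * ∑ x, f x ^ p)) / Fintype.card (Bt d K) := by
          gcongr; exact mm_doob ι p hp K f hf
      _ = _ := by field_simp

noncomputable def gg {K : ℕ} (j : ℕ) (f : G → ℝ) (X : G × Bt d K) : ℝ :=
  if j < K then FF ι j f X - FF ι (j + 1) f X else FF ι K f X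

lemma avg_gg {K : ℕ} (j : ℕ) (f : G → ℝ) (x : G) :
    (∑ b : Bt d K, gg ι j f (x, b)) / Fintype.card (Bt d K) = cv (kD ι K j) f x := by
  unfold gg kD
  split_ifs
  · rw [Finset.sum_sub_distrib, sub_div, avg_FF, avg_FF, cv_sub_left]; rfl
  · exact avg_FF ι K f x

lemma gg_sum {K : ℕ} (f : G → ℝ) (X : G × Bt d K) :
    ∑ j ∈ Finset.range (K + 1), gg ι j f X ^ 2 = FF ι (K - 0) f X ^ 2 +
      ∑ i ∈ Finset.range K, (FF ι (K - (i + 1)) f X - FF ι (K - i) f X) ^ 2 := by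
  rw [Finset.sum_range_succ, add_comm]
  congr 1
  · simp [gg]
  · rw [← Finset.sum_range_reflect]
    refine Finset.sum_congr rfl fun i hi => ?_
    have hi := Finset.mem_range.1 hi
    unfold gg
    rw [if_pos (by omega)]
    rw [show K - 1 - i = K - (i + 1) by omega, show K - (i + 1) + 1 = K - i by omega]

lemma LP (p r : ℝ) (hp : 1 < p) (hr : r = 2 * p / (p + 1)) (K : ℕ) (f : G → ℝ) (hf : ∀ x, 0 ≤ f x) :
    ∃ u : G → ℝ, (∀ x, 0 ≤ u x) ∧
      (∀ j ≤ K, ∀ x, u x = 0 → cv (kD ι K j) f x = 0) ∧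
      ∑ j ∈ Finset.range (K + 1), ∑ x, (cv (kD ι K j) f x) ^ 2 / u x ≤
        (2 / (r * (r - 1))) * ∑ x, f x ^ r ∧
      ∑ x, u x ^ p ≤ (r / (r - 1)) ^ r * ∑ x, f x ^ r := by
  have hB := card_Bt_pos (d := d) K
  have hr1 : 1 < r := by rw [hr, lt_div_iff₀ (by linarith)]; linarith
  have hr2 : r < 2 := by rw [hr, div_lt_iff₀ (by linarith)]; linarith
  have hpr : (2 - r) * p = r := by rw [hr]; field_simp; ring
  have hm0 := fun X : G × Bt d K => mm_nonneg ι f hf X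
  let D : G × Bt d K → ℝ := fun X => mm ι K f X ^ (2 - r)
  have hD0 : ∀ X, 0 ≤ D X := fun X => Real.rpow_nonneg (hm0 X) _
  have hz : ∀ j ≤ K, ∀ X, D X = 0 → gg ι j f X = 0 := by
    intro j hj X hX
    have h0 : mm ι K f X = 0 := (Real.rpow_eq_zero (hm0 X) (by linarith)).1 hX
    have hFF : ∀ n ≤ K, FF ι n f X = 0 := fun n hn =>
      le_antisymm (h0 ▸ le_mm ι hn f X) (FF_nonneg ι n f hf X)
    unfold gg
    split_ifs with h
    · rw [hFF j hj, hFF (j + 1) h, sub_zero]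
    · exact hFF K le_rfl
  refine ⟨fun x => (∑ b : Bt d K, D (x, b)) / Fintype.card (Bt d K),
    fun x => div_nonneg (Finset.sum_nonneg fun _ _ => hD0 _) hB.le, ?_, ?_, ?_⟩
  · intro j hj x hx
    simp only at hx
    rw [_root_.div_eq_zero_iff, or_iff_left hB.ne', Finset.sum_eq_zero_iff_of_nonneg fun _ _ => hD0 _] at hx
    rw [← avg_gg, Finset.sum_eq_zero fun b hb => hz j hj _ (hx b hb), zero_div]
  · have hpt : ∀ j ∈ Finset.range (K + 1), ∀ x, (cv (kD ι K j) f x) ^ 2 /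
        ((∑ b : Bt d K, D (x, b)) / Fintype.card (Bt d K)) ≤
        (∑ b : Bt d K, gg ι j f (x, b) ^ 2 / D (x, b)) / Fintype.card (Bt d K) := by
      intro j hj x
      have hj : j ≤ K := by have := Finset.mem_range.1 hj; omega
      have hCS : (∑ b : Bt d K, gg ι j f (x, b)) ^ 2 ≤
          (∑ b : Bt d K, gg ι j f (x, b) ^ 2 / D (x, b)) * ∑ b : Bt d K, D (x, b) := by
        apply Finset.sum_sq_le_sum_mul_sum_of_sq_le_mul
        · intro b _; exact div_nonneg (sq_nonneg _) (hD0 _)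
        · intro b _; exact hD0 _
        · intro b _
          by_cases h : D (x, b) = 0
          · rw [hz j hj _ h]; simp
          · rw [div_mul_cancel₀ _ h]
      rw [← avg_gg]
      have hS0 : 0 ≤ ∑ b : Bt d K, D (x, b) := Finset.sum_nonneg fun _ _ => hD0 _
      have hT0 : 0 ≤ ∑ b : Bt d K, gg ι j f (x, b) ^ 2 / D (x, b) :=
        Finset.sum_nonneg fun _ _ => div_nonneg (sq_nonneg _) (hD0 _)
      refine div_le_of_le_mul₀ (by positivity) (by positivity) ?_
      rw [div_pow, div_mul_div_comm, ← sq]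
      gcongr
    calc _ ≤ ∑ j ∈ Finset.range (K + 1), ∑ x,
          (∑ b : Bt d K, gg ι j f (x, b) ^ 2 / D (x, b)) / Fintype.card (Bt d K) :=
        Finset.sum_le_sum fun j hj => Finset.sum_le_sum fun x _ => hpt j hj x
      _ = (∑ X : G × Bt d K, (∑ j ∈ Finset.range (K + 1), gg ι j f X ^ 2) / D X) /
          Fintype.card (Bt d K) := by
        simp only [← Finset.sum_div]
        congr 1
        rw [Fintype.sum_prod_type]
        simp only [Finset.sum_div]
        rw [Finset.sum_comm]
        refine Finset.sum_congr rfl fun x _ => ?_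
        rw [Finset.sum_comm]
      _ ≤ ((2 / (r * (r - 1))) * (Fintype.card (Bt d K) * ∑ x, f x ^ r)) / Fintype.card (Bt d K) := by
        gcongr
        obtain ⟨h1, h2, h3⟩ := mart_hyps ι K f
        have := sqfun r hr1 hr2 K (fun i => FF (K := K) ι (K - i) f) (fun i => RR ι (K - i))
          (fun i x => FF_nonneg ι _ f hf x) h1 h2 h3
        simp only [gg_sum]
        refine this.trans (le_of_eq ?_)
        simp only [Nat.sub_self, FF_zero]
        rw [Fintype.sum_prod_type]
        simp only [Finset.sum_const, Finset.card_univ, nsmul_eq_mul, Finset.mul_sum]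
      _ = _ := by field_simp
  · calc _ ≤ ∑ x, (∑ b : Bt d K, D (x, b) ^ p) / Fintype.card (Bt d K) :=
          Finset.sum_le_sum fun x _ => avg_rpow _ (fun b => hD0 _) p hp.le
      _ = (∑ X : G × Bt d K, mm ι K f X ^ r) / Fintype.card (Bt d K) := by
          rw [← Finset.sum_div, Fintype.sum_prod_type]
          simp only [D, ← Real.rpow_mul (hm0 _), hpr]
      _ ≤ ((r / (r - 1)) ^ r * (Fintype.card (Bt d K) * ∑ x, f x ^ r)) / Fintype.card (Bt d K) := by
          gcongr; exact mm_doob ι r hr1 K f hf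
      _ = _ := by field_simp
end lp


section boot
variable {G : Type} [Fintype G] [AddCommGroup G] {d : ℕ} (ι : (Fin d → ℤ) →+ G)

noncomputable def fam (K : ℕ) : Fin (2 ^ K) ⊕ Fin (K + 1) → G → ℝ
  | Sum.inl N => kA ι N
  | Sum.inr n => kS ι K n

lemma fam_prob (K : ℕ) (a : Fin (2 ^ K) ⊕ Fin (K + 1)) : IsProb (fam ι K a) := by
  cases a
  · exact kA_prob _ _
  · exact kS_prob _ _ _

noncomputable def MX (K : ℕ) (f : G → ℝ) (x : G) : ℝ :=
  Finset.univ.sup' ⟨Sum.inr 0, Finset.mem_univ _⟩ fun a => cv (fam ι K a) f x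

lemma le_MX (K : ℕ) (f : G → ℝ) (x : G) (a) : cv (fam ι K a) f x ≤ MX ι K f x :=
  Finset.le_sup' (fun a => cv (fam ι K a) f x) (Finset.mem_univ a)

lemma MX_nonneg (K : ℕ) (f : G → ℝ) (hf : ∀ x, 0 ≤ f x) (x : G) : 0 ≤ MX ι K f x :=
  (cv_nonneg (fam_prob ι K _) hf x).trans (le_MX ι K f x (Sum.inr 0))

lemma kA_le_MX (K N : ℕ) (hN : N < 2 ^ K) (f : G → ℝ) (x : G) : cv (kA ι N) f x ≤ MX ι K f x :=
  le_MX ι K f x (Sum.inl ⟨N, hN⟩)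

lemma kS_le_MX (K n : ℕ) (hn : n ≤ K) (f : G → ℝ) (x : G) : cv (kS ι K n) f x ≤ MX ι K f x :=
  le_MX ι K f x (Sum.inr ⟨n, by omega⟩)

def Val (p : ℝ) (K : ℕ) (B : ℝ) : Prop :=
  ∀ f : G → ℝ, (∀ x, 0 ≤ f x) → ∑ x, MX ι K f x ^ p ≤ B * ∑ x, f x ^ p

lemma Val_apriori (p : ℝ) (hp : 1 ≤ p) (K : ℕ) :
    Val ι p K (Fintype.card (Fin (2 ^ K) ⊕ Fin (K + 1))) := by
  intro f hf
  have hf' : ∀ x, 0 ≤ f x ^ p := fun x => Real.rpow_nonneg (hf x) p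
  calc ∑ x, MX ι K f x ^ p ≤ ∑ x, ∑ a, cv (fam ι K a) (fun y => f y ^ p) x := by
        refine Finset.sum_le_sum fun x _ => ?_
        obtain ⟨a, -, ha⟩ := Finset.exists_mem_eq_sup' (s := (Finset.univ : Finset (Fin (2 ^ K) ⊕ Fin (K + 1))))
          ⟨Sum.inr 0, Finset.mem_univ _⟩ (fun a => cv (fam ι K a) f x)
        unfold MX
        rw [ha]
        refine (cv_rpow_le (fam_prob ι K a) f hf p hp x).trans ?_
        exact Finset.single_le_sum (f := fun a => cv (fam ι K a) (fun y => f y ^ p) x)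
          (fun a _ => cv_nonneg (fam_prob ι K a) hf' x) (Finset.mem_univ a)
    _ = _ := by
        rw [Finset.sum_comm]
        simp only [sum_cv (fam_prob ι K _)]
        simp only [Finset.sum_const, Finset.card_univ, nsmul_eq_mul]

lemma cv_sum_right {I : Type*} (s : Finset I) (w : G → ℝ) (g : I → G → ℝ) (x : G) :
    cv w (fun y => ∑ i ∈ s, g i y) x = ∑ i ∈ s, cv w (g i) x := by
  simp only [cv, Finset.mul_sum]
  rw [Finset.sum_comm]

lemma cv_kS_zero (K : ℕ) (f : G → ℝ) (x : G) : cv (kS ι K 0) f x = f x := by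
  have hB := card_Bt_pos (d := d) K
  rw [← avg_FF]
  simp only [FF_zero, Finset.sum_const, Finset.card_univ, nsmul_eq_mul]
  field_simp

lemma cv_kA_zero (f : G → ℝ) (x : G) : cv (kA ι 0) f x = f x := by
  have : box d 0 = {0} := by
    unfold box
    simp only [Nat.cast_zero, neg_zero]
    exact Finset.Icc_self _
  unfold kA
  rw [cv_ker, this]
  simp

lemma sum_kD (K : ℕ) (f : G → ℝ) (x : G) : ∑ j ∈ Finset.range (K + 1), cv (kD ι K j) f x = f x := by
  rw [Finset.sum_range_succ]
  have : ∑ j ∈ Finset.range K, cv (kD ι K j) f x =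
      ∑ j ∈ Finset.range K, (cv (kS ι K j) f x - cv (kS ι K (j + 1)) f x) :=
    Finset.sum_congr rfl fun j hj => by
      unfold kD; rw [if_pos (Finset.mem_range.1 hj), cv_sub_left]; rfl
  rw [this, Finset.sum_range_sub', cv_kS_zero]
  simp [kD]

lemma sum_dist (K n : ℕ) (hn : n < K) (g : ℕ → ℝ) (hg : ∀ s, 0 ≤ g s) :
    ∑ j ∈ Finset.range (K + 1), g ((j - n) + (n - j)) ≤ 2 * ∑ s ∈ Finset.range (K + 1), g s := by
  have h1 : ∀ j ∈ Finset.range (K + 1), g ((j - n) + (n - j)) =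
      ∑ s ∈ Finset.range (K + 1), if (j - n) + (n - j) = s then g s else 0 := by
    intro j hj
    have hj := Finset.mem_range.1 hj
    rw [Finset.sum_ite_eq, if_pos]
    rw [Finset.mem_range]; omega
  rw [Finset.sum_congr rfl h1, Finset.sum_comm, Finset.mul_sum]
  refine Finset.sum_le_sum fun s _ => ?_
  rw [← Finset.sum_filter, Finset.sum_const, nsmul_eq_mul]
  refine mul_le_mul_of_nonneg_right ?_ (hg s)
  have : (Finset.filter (fun j => (j - n) + (n - j) = s) (Finset.range (K + 1))) ⊆ {n + s, n - s} := by
    intro j hj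
    simp only [Finset.mem_filter, Finset.mem_insert, Finset.mem_singleton] at *
    omega
  exact_mod_cast (Finset.card_le_card this).trans Finset.card_le_two

lemma tau_le (K n l m : ℕ) (hl : l ≤ n) (hn : n < K) (hm : m < 2 ^ l) (f : G → ℝ) (x : G) :
    cv (k1 ι n l m - k2 ι K n l m) f x ≤ 2 * ∑ s ∈ Finset.range (K + 1), QQ ι K l s f x := by
  have e : cv (k1 ι n l m - k2 ι K n l m) f x =
      ∑ j ∈ Finset.range (K + 1), cv (k1 ι n l m - k2 ι K n l m) (cv (kD ι K j) f) x := by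
    rw [← cv_sum_right]
    congr 1
    funext y
    exact (sum_kD ι K f y).symm
  rw [e]
  refine le_trans (Finset.sum_le_sum fun j hj => ?_)
    (sum_dist K n hn (fun s => QQ ι K l s f x) fun s => QQ_nonneg ι K l s f x)
  have hj := Finset.mem_range.1 hj
  have hmem : ((n, j, m) : ℕ × ℕ × ℕ) ∈ idx K l ((j - n) + (n - j)) := by
    unfold idx
    rw [Finset.mem_filter, Finset.mem_product, Finset.mem_product, Finset.mem_range, Finset.mem_range,
      Finset.mem_range]
    exact ⟨⟨hn, hj, hm⟩, hl, rfl⟩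
  have hs := Finset.single_le_sum (f := fun i : ℕ × ℕ × ℕ =>
    (cv (k1 ι i.1 l i.2.2 - k2 ι K i.1 l i.2.2) (cv (kD ι K i.2.1) f) x) ^ 2)
    (fun i _ => sq_nonneg _) hmem
  exact Real.le_sqrt_of_sq_le hs

lemma kA_decomp (K n N : ℕ) (h1 : 2 ^ n ≤ N) (h2 : N < 2 ^ (n + 1)) (f : G → ℝ) (x : G) :
    cv (kA ι N) f x = cv (kS ι K (n + 1)) f x + ∑ l ∈ Finset.range (n + 1),
      cv (k1 ι n l ((N - 2 ^ n) / 2 ^ (n - l)) - k2 ι K n l ((N - 2 ^ n) / 2 ^ (n - l))) f x := by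
  have key : ∀ L ≤ n, cv (k1 ι n L ((N - 2 ^ n) / 2 ^ (n - L))) f x =
      cv (kS ι K (n + 1)) f x + ∑ l ∈ Finset.range (L + 1),
      cv (k1 ι n l ((N - 2 ^ n) / 2 ^ (n - l)) - k2 ι K n l ((N - 2 ^ n) / 2 ^ (n - l))) f x := by
    intro L
    induction L with
    | zero =>
      intro _
      simp only [zero_add, Finset.range_one, Finset.sum_singleton, cv_sub_left, Pi.sub_apply, k2, if_true]
      ring
    | succ L ih =>
      intro hL
      rw [Finset.sum_range_succ, ← add_assoc, ← ih (by omega), cv_sub_left, Pi.sub_apply]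
      have : k2 ι K n (L + 1) ((N - 2 ^ n) / 2 ^ (n - (L + 1))) = k1 ι n L ((N - 2 ^ n) / 2 ^ (n - L)) := by
        unfold k2 k1
        rw [if_neg (by omega), Nat.div_div_eq_div_mul, ← pow_succ, show n - (L + 1) + 1 = n - L by omega]
      rw [this]; ring
  rw [← key n le_rfl]
  unfold k1
  simp only [Nat.sub_self, pow_zero, Nat.div_one, mul_one]
  rw [Nat.add_sub_cancel' h1]

lemma MX_le (K : ℕ) (f : G → ℝ) (hf : ∀ x, 0 ≤ f x) (m : G → ℝ)
    (hm : ∀ n ≤ K, ∀ x, cv (kS ι K n) f x ≤ m x) (x : G) :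
    MX ι K f x ≤ m x + 2 * ∑ i ∈ Finset.range K ×ˢ Finset.range (K + 1), QQ ι K i.1 i.2 f x := by
  have hS : 0 ≤ ∑ i ∈ Finset.range K ×ˢ Finset.range (K + 1), QQ ι K i.1 i.2 f x :=
    Finset.sum_nonneg fun _ _ => QQ_nonneg _ _ _ _ _ _
  apply Finset.sup'_le
  rintro (N | n) -
  · simp only [fam]
    rcases Nat.eq_zero_or_pos (N:ℕ) with h0 | h0
    · rw [h0, cv_kA_zero]
      have := hm 0 (by omega) x
      rw [cv_kS_zero] at this
      linarith
    · obtain ⟨n, hn⟩ : ∃ n, n = Nat.log 2 N := ⟨_, rfl⟩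
      have h1 : 2 ^ n ≤ (N:ℕ) := hn ▸ Nat.pow_log_le_self 2 h0.ne'
      have h2 : (N:ℕ) < 2 ^ (n + 1) := hn ▸ Nat.lt_pow_succ_log_self (by norm_num) _
      have hnK : n < K := by
        by_contra h
        have := Nat.pow_le_pow_right (n := 2) (by norm_num) (not_lt.1 h)
        have := N.2
        omega
      rw [kA_decomp ι K n N h1 h2]
      refine add_le_add (hm _ (by omega) x) ?_
      rw [Finset.sum_product, Finset.mul_sum]
      refine le_trans (Finset.sum_le_sum fun l hl => tau_le ι K n l _ ?_ hnK ?_ f x) ?_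
      · have := Finset.mem_range.1 hl; omega
      · have hl := Finset.mem_range.1 hl
        rw [Nat.div_lt_iff_lt_mul (by positivity), ← pow_add, Nat.add_sub_cancel' (by omega)]
        rw [pow_succ] at h2; omega
      · apply Finset.sum_le_sum_of_subset_of_nonneg
        · intro l hl; rw [Finset.mem_range] at *; omega
        · intro l _ _
          exact mul_nonneg (by norm_num) (Finset.sum_nonneg fun _ _ => QQ_nonneg _ _ _ _ _ _)
  · have := hm n (by omega) x
    simp only [fam]
    linarith

lemma QQ_Lr (p r : ℝ) (hp : 1 < p) (hr : r = 2 * p / (p + 1)) (K : ℕ) (B : ℝ) (hB : 0 ≤ B)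
    (hV : Val ι p K B) (l s : ℕ) (f : G → ℝ) (hf : ∀ x, 0 ≤ f x) :
    ∑ x, QQ ι K l s f x ^ r ≤
      (8 * (2 / (r * (r - 1)))) ^ (r / 2) * ((r / (r - 1)) ^ r) ^ (1 - r / 2) *
        ((2:ℝ) ^ l) ^ (r / 2) * B ^ (1 - r / 2) * ∑ x, f x ^ r := by
  have hr1 : 1 < r := by rw [hr, lt_div_iff₀ (by linarith)]; linarith
  have hr2 : r < 2 := by rw [hr, div_lt_iff₀ (by linarith)]; linarith
  obtain ⟨u, hu0, huz, hu1, hu2⟩ := LP ι p r hp hr K f hf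
  have h := vec p r hp hr (idx K l s) (fun i => k1 ι i.1 l i.2.2) (fun i => k2 ι K i.1 l i.2.2)
    (fun i _ => k1_prob _ _ _ _) (fun i _ => k2_prob _ _ _ _ _) (fun i => cv (kD ι K i.2.1) f)
    u (MX ι K u) hu0 (MX_nonneg ι K u hu0) (fun i hi x => huz _ (idx_mem hi).2.1 x) ?_ ?_
  · refine h.trans ?_
    set S := ∑ x, f x ^ r with hS
    have hS0 : 0 ≤ S := Finset.sum_nonneg fun x _ => Real.rpow_nonneg (hf x) _
    have hC1 : 0 ≤ 2 / (r * (r - 1)) := by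
      have : 0 < r - 1 := by linarith
      positivity
    have hC2 : 0 ≤ (r / (r - 1)) ^ r := by
      have : 0 < r - 1 := by linarith
      positivity
    have a1 : 4 * ∑ i ∈ idx K l s, ∑ x, cv (kD ι K i.2.1) f x ^ 2 / u x ≤
        (8 * (2 / (r * (r - 1)))) * 2 ^ l * S := by
      have := idx_sum K l s (fun j => ∑ x, cv (kD ι K j) f x ^ 2 / u x)
        (fun j => Finset.sum_nonneg fun x _ => div_nonneg (sq_nonneg _) (hu0 x))
      have h2 := mul_le_mul_of_nonneg_left hu1 (show (0:ℝ) ≤ 2 * 2 ^ l by positivity)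
      nlinarith
    have a2 : ∑ x, MX ι K u x ^ p ≤ (r / (r - 1)) ^ r * B * S := by
      refine (hV u hu0).trans ?_
      have := mul_le_mul_of_nonneg_left hu2 hB
      linarith
    have n1 : 0 ≤ 4 * ∑ i ∈ idx K l s, ∑ x, cv (kD ι K i.2.1) f x ^ 2 / u x :=
      mul_nonneg (by norm_num) (Finset.sum_nonneg fun _ _ => Finset.sum_nonneg fun x _ =>
        div_nonneg (sq_nonneg _) (hu0 x))
    have n2 : 0 ≤ ∑ x, MX ι K u x ^ p := Finset.sum_nonneg fun x _ =>
      Real.rpow_nonneg (MX_nonneg ι K u hu0 x) _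
    calc _ ≤ ((8 * (2 / (r * (r - 1)))) * 2 ^ l * S) ^ (r / 2) *
          ((r / (r - 1)) ^ r * B * S) ^ (1 - r / 2) := by
          refine mul_le_mul (Real.rpow_le_rpow n1 a1 (by linarith))
            (Real.rpow_le_rpow n2 a2 (by linarith)) (Real.rpow_nonneg n2 _) (by positivity)
      _ = _ := by
          rw [Real.mul_rpow (by positivity) hS0, Real.mul_rpow (by positivity) (by positivity),
            Real.mul_rpow (by positivity) hS0, Real.mul_rpow hC2 hB]
          have : S ^ (r / 2) * S ^ (1 - r / 2) = S := by
            rw [← Real.rpow_add_of_nonneg hS0 (by linarith) (by linarith)]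
            rw [show r / 2 + (1 - r / 2) = 1 by ring, Real.rpow_one]
          calc _ = (8 * (2 / (r * (r - 1)))) ^ (r / 2) * ((r / (r - 1)) ^ r) ^ (1 - r / 2) *
              ((2:ℝ) ^ l) ^ (r / 2) * B ^ (1 - r / 2) * (S ^ (r / 2) * S ^ (1 - r / 2)) := by ring
            _ = _ := by rw [this]
  · intro i hi x
    obtain ⟨h1, h2, h3, h4, h5⟩ := idx_mem hi
    refine kA_le_MX ι K _ ?_ u x
    exact (idx_arith i.1 l i.2.2 h4 h3).1.trans_le (Nat.pow_le_pow_right (by norm_num) h1)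
  · intro i hi x
    obtain ⟨h1, h2, h3, h4, h5⟩ := idx_mem hi
    simp only [k2]
    split_ifs with h0
    · exact kS_le_MX ι K _ h1 u x
    · refine kA_le_MX ι K _ ?_ u x
      obtain ⟨a1, a2⟩ := idx_arith i.1 l i.2.2 h4 h3
      have := a2 h0
      have := Nat.pow_le_pow_right (n := 2) (by norm_num) (show i.1 + 1 ≤ K from h1)
      omega
end boot


lemma min_le_geom (X Y ε : ℝ) (hX : 0 < X) (hY : 0 < Y) (h0 : 0 ≤ ε) (h1 : ε ≤ 1) :
    min X Y ≤ X ^ (1 - ε) * Y ^ ε := by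
  have hm : 0 < min X Y := lt_min hX hY
  calc min X Y = (min X Y) ^ (1 - ε) * (min X Y) ^ ε := by
        rw [← Real.rpow_add hm]; simp
    _ ≤ _ := by
        gcongr
        · exact min_le_left _ _
        · exact min_le_right _ _

lemma QQ_Lp (p : ℝ) (hp : 3 / 2 < p) (hp2 : p < 2) :
    ∃ C q1 q2 : ℝ, 0 < C ∧ 0 < q1 ∧ q1 < 1 ∧ 0 < q2 ∧ q2 < 1 ∧
      ∀ (G : Type) [Fintype G] [AddCommGroup G] (d : ℕ) (ι : (Fin d → ℤ) →+ G) (K : ℕ) (B : ℝ),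
        1 ≤ B → Val ι p K B → ∀ (l s : ℕ) (f : G → ℝ), (∀ x, 0 ≤ f x) →
        ∑ x, QQ ι K l s f x ^ p ≤ C * B ^ ((2 - p) / 2) * (q1 ^ l * q2 ^ s) * ∑ x, f x ^ p := by
  obtain ⟨r, hr⟩ : ∃ r, r = 2 * p / (p + 1) := ⟨_, rfl⟩
  have hr1 : 1 < r := by rw [hr, lt_div_iff₀ (by linarith)]; linarith
  have hrp : r < p := by rw [hr, div_lt_iff₀ (by linarith)]; nlinarith
  have hp1 : p + 1 ≠ 0 := by linarith
  obtain ⟨Ca, hCa⟩ : ∃ Ca, Ca = (8 * (2 / (r * (r - 1)))) ^ (r / 2) * ((r / (r - 1)) ^ r) ^ (1 - r / 2) :=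
    ⟨_, rfl⟩
  have hCa0 : 0 < Ca := by
    have : 0 < r - 1 := by linarith
    rw [hCa]; positivity
  obtain ⟨ε, hε⟩ : ∃ ε, ε = (2 * p - 3) / 4 := ⟨_, rfl⟩
  have he1 : (2 - p) / (2 - r) = (2 - p) * (p + 1) / 2 := by
    have : 2 - r = 2 / (p + 1) := by rw [hr]; field_simp; ring
    rw [this]; field_simp
  have he2 : (p - r) / (2 - r) = p * (p - 1) / 2 := by
    have : 2 - r = 2 / (p + 1) := by rw [hr]; field_simp; ring
    rw [this, hr]; field_simp; ring
  have k1 : 0 < p * (2 * p - 3) * (3 - p) / 4 := by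
    have : 0 < 2 * p - 3 := by linarith
    have : 0 < 3 - p := by linarith
    positivity
  have k2 : 0 < ε * (p * (p - 1) / 2) := by
    have : 0 < ε := by rw [hε]; linarith
    have : 0 < p - 1 := by linarith
    positivity
  refine ⟨marcC r p * (Ca ^ ((2 - p) / (2 - r)) * 28800 ^ ((p - r) / (2 - r))),
    2 ^ (-(p * (2 * p - 3) * (3 - p) / 4)), 4 ^ (-(ε * (p * (p - 1) / 2))), ?_, by positivity,
    Real.rpow_lt_one_of_one_lt_of_neg (by norm_num) (by linarith), by positivity,
    Real.rpow_lt_one_of_one_lt_of_neg (by norm_num) (by linarith), ?_⟩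
  · have := marcC_pos r p hrp hp2
    positivity
  intro G _ _ d ι K B hB hV l s f hf
  have hL : (0:ℝ) < 2 ^ l := by positivity
  have hS : (0:ℝ) < 4 ^ s := by positivity
  have hB0 : 0 < B := by linarith
  have hmin : min ((2:ℝ) ^ l)⁻¹ (2 ^ l * (4 ^ s)⁻¹) ≤ ((2:ℝ) ^ l) ^ (2 * ε - 1) * ((4:ℝ) ^ s) ^ (-ε) := by
    refine (min_le_geom _ _ ε (by positivity) (by positivity) (by rw [hε]; linarith)
      (by rw [hε]; linarith)).trans (le_of_eq ?_)
    rw [Real.mul_rpow hL.le (by positivity), Real.inv_rpow hL.le, Real.inv_rpow hS.le,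
      ← Real.rpow_neg hL.le, ← Real.rpow_neg hS.le, ← mul_assoc, ← Real.rpow_add hL]
    congr 2; ring
  have h := marc r p (by linarith) hrp hp2 (QQ ι K l s) (fun f x => QQ_nonneg ι K l s f x)
    (fun f g x => QQ_add ι K l s f g x)
    (Ca * ((2:ℝ) ^ l) ^ (r / 2) * B ^ (1 - r / 2))
    (28800 * (((2:ℝ) ^ l) ^ (2 * ε - 1) * ((4:ℝ) ^ s) ^ (-ε))) (by positivity) (by positivity)
    (fun f hf => by
      have := QQ_Lr ι p r (by linarith) hr K B hB0.le hV l s f hf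
      rw [← hCa] at this
      exact this)
    (fun f hf => by
      refine (QQ_L2 ι K l s f).trans ?_
      refine mul_le_mul_of_nonneg_right (mul_le_mul_of_nonneg_left hmin (by norm_num)) ?_
      exact Finset.sum_nonneg fun x _ => Real.rpow_nonneg (hf x) _) f hf
  refine h.trans (le_of_eq ?_)
  congr 1
  rw [Real.mul_rpow (by positivity) (by positivity), Real.mul_rpow (by positivity) (by positivity),
    Real.mul_rpow (by positivity) (by positivity), Real.mul_rpow (by positivity) (by positivity),
    ← Real.rpow_mul hL.le, ← Real.rpow_mul hL.le, ← Real.rpow_mul hS.le, ← Real.rpow_mul hB0.le]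
  have x1 : (1 - r / 2) * ((2 - p) / (2 - r)) = (2 - p) / 2 := by
    rw [he1, hr]; field_simp; ring
  have x2 : r / 2 * ((2 - p) / (2 - r)) + (2 * ε - 1) * ((p - r) / (2 - r)) =
      -(p * (2 * p - 3) * (3 - p) / 4) := by
    rw [he1, he2, hr, hε]; field_simp; ring
  have x3 : -ε * ((p - r) / (2 - r)) = -(ε * (p * (p - 1) / 2)) := by rw [he2]; ring
  have y1 : ∀ (b κ : ℝ) (n : ℕ), 0 ≤ b → (b ^ κ) ^ n = (b ^ n) ^ κ := by
    intro b κ n hb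
    rw [← Real.rpow_natCast, ← Real.rpow_natCast, ← Real.rpow_mul hb, ← Real.rpow_mul hb, mul_comm]
  rw [y1 2 _ l (by norm_num), y1 4 _ s (by norm_num), ← x2, ← x3, x1, Real.rpow_add hL]
  ring

lemma sumLp {X I : Type*} [Fintype X] (p : ℝ) (hp : 1 < p) (s : Finset I) (y : I → X → ℝ)
    (hy : ∀ i x, 0 ≤ y i x) (c : I → ℝ) (hc : ∀ i, 0 < c i) (T Z : ℝ) (hT : 0 ≤ T)
    (h : ∀ i ∈ s, ∑ x, y i x ^ p ≤ c i ^ p * T) (hZ : ∑ i ∈ s, c i ≤ Z) :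
    ∑ x, (∑ i ∈ s, y i x) ^ p ≤ Z ^ p * T := by
  have hc0 : 0 ≤ ∑ i ∈ s, c i := Finset.sum_nonneg fun i _ => (hc i).le
  have hZ0 : 0 ≤ Z := hc0.trans hZ
  have step : ∀ x, (∑ i ∈ s, y i x) ^ p ≤ (∑ i ∈ s, c i) ^ (p - 1) * ∑ i ∈ s, c i * (y i x / c i) ^ p := by
    intro x
    have := Real.inner_le_weight_mul_Lp_of_nonneg s (p := p) hp.le c (fun i => y i x / c i)
      (fun i => (hc i).le) (fun i => div_nonneg (hy i x) (hc i).le)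
    have e : ∑ i ∈ s, c i * (y i x / c i) = ∑ i ∈ s, y i x :=
      Finset.sum_congr rfl fun i _ => mul_div_cancel₀ _ (hc i).ne'
    rw [e] at this
    have n : 0 ≤ ∑ i ∈ s, c i * (y i x / c i) ^ p := Finset.sum_nonneg fun i _ =>
      mul_nonneg (hc i).le (Real.rpow_nonneg (div_nonneg (hy i x) (hc i).le) _)
    refine (Real.rpow_le_rpow (Finset.sum_nonneg fun i _ => hy i x) this (by linarith)).trans (le_of_eq ?_)
    rw [Real.mul_rpow (Real.rpow_nonneg hc0 _) (Real.rpow_nonneg n _), ← Real.rpow_mul hc0,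
      ← Real.rpow_mul n, inv_mul_cancel₀ (by linarith), Real.rpow_one]
    congr 2
    field_simp
  calc ∑ x, (∑ i ∈ s, y i x) ^ p
      ≤ ∑ x, (∑ i ∈ s, c i) ^ (p - 1) * ∑ i ∈ s, c i * (y i x / c i) ^ p :=
        Finset.sum_le_sum fun x _ => step x
    _ = (∑ i ∈ s, c i) ^ (p - 1) * ∑ i ∈ s, c i * ((∑ x, y i x ^ p) / c i ^ p) := by
        rw [← Finset.mul_sum, Finset.sum_comm]
        congr 1
        refine Finset.sum_congr rfl fun i _ => ?_
        rw [← Finset.mul_sum, Finset.sum_div]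
        congr 1
        exact Finset.sum_congr rfl fun x _ => Real.div_rpow (hy i x) (hc i).le _
    _ ≤ (∑ i ∈ s, c i) ^ (p - 1) * ∑ i ∈ s, c i * T := by
        refine mul_le_mul_of_nonneg_left (Finset.sum_le_sum fun i hi => ?_) (Real.rpow_nonneg hc0 _)
        refine mul_le_mul_of_nonneg_left ?_ (hc i).le
        rw [div_le_iff₀ (Real.rpow_pos_of_pos (hc i) _), mul_comm]
        exact h i hi
    _ = (∑ i ∈ s, c i) ^ p * T := by
        rw [← Finset.sum_mul, ← mul_assoc]
        congr 1
        rcases hc0.eq_or_lt with h0 | h0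
        · rw [← h0, mul_zero, Real.zero_rpow (by linarith)]
        · nth_rewrite 2 [← Real.rpow_one (∑ i ∈ s, c i)]
          rw [← Real.rpow_add h0]; congr 1; ring
    _ ≤ _ := mul_le_mul_of_nonneg_right (Real.rpow_le_rpow hc0 hZ (by linarith)) hT

lemma add_rpow_two {a b p : ℝ} (ha : 0 ≤ a) (hb : 0 ≤ b) (hp : 1 ≤ p) :
    (a + b) ^ p ≤ 2 ^ (p - 1) * (a ^ p + b ^ p) := by
  lift a to NNReal using ha
  lift b to NNReal using hb
  exact_mod_cast NNReal.rpow_add_le_mul_rpow_add_rpow a b hp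

lemma boot1 (p : ℝ) (hp : 3 / 2 < p) (hp2 : p < 2) :
    ∃ C : ℝ, 0 < C ∧
      ∀ (G : Type) [Fintype G] [AddCommGroup G] (d : ℕ) (ι : (Fin d → ℤ) →+ G) (K : ℕ) (B : ℝ),
        1 ≤ B → Val ι p K B → Val ι p K (C * B ^ ((2 - p) / 2)) := by
  obtain ⟨C, q1, q2, hC, h1, h1', h2, h2', H⟩ := QQ_Lp p hp hp2
  have hp0 : 0 < p := by linarith
  obtain ⟨w1, hw1⟩ : ∃ w, w = q1 ^ (1 / p) := ⟨_, rfl⟩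
  obtain ⟨w2, hw2⟩ : ∃ w, w = q2 ^ (1 / p) := ⟨_, rfl⟩
  have a1 : 0 < w1 := by rw [hw1]; positivity
  have a2 : 0 < w2 := by rw [hw2]; positivity
  have b1 : w1 < 1 := by rw [hw1]; exact Real.rpow_lt_one h1.le h1' (by positivity)
  have b2 : w2 < 1 := by rw [hw2]; exact Real.rpow_lt_one h2.le h2' (by positivity)
  have e1 : w1 ^ p = q1 := by rw [hw1, ← Real.rpow_mul h1.le, one_div_mul_cancel hp0.ne', Real.rpow_one]
  have e2 : w2 ^ p = q2 := by rw [hw2, ← Real.rpow_mul h2.le, one_div_mul_cancel hp0.ne', Real.rpow_one]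
  obtain ⟨Z, hZ⟩ : ∃ Z, Z = (1 - w1)⁻¹ * (1 - w2)⁻¹ := ⟨_, rfl⟩
  have hZ0 : 0 < Z := by
    have : 0 < 1 - w1 := by linarith
    have : 0 < 1 - w2 := by linarith
    rw [hZ]; positivity
  have hA : 0 < (p / (p - 1)) ^ p := by
    have : 0 < p - 1 := by linarith
    positivity
  refine ⟨2 ^ (p - 1) * ((p / (p - 1)) ^ p + 2 ^ p * (Z ^ p * C)), by positivity, ?_⟩
  intro G _ _ d ι K B hB hV f hf
  obtain ⟨m, hm0, hm, hms⟩ := Sstar ι p (by linarith) K f hf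
  have hT : 0 ≤ ∑ x, f x ^ p := Finset.sum_nonneg fun x _ => Real.rpow_nonneg (hf x) _
  have hBa : 1 ≤ B ^ ((2 - p) / 2) := Real.one_le_rpow hB (by linarith)
  set T := ∑ x, f x ^ p with hTdef
  set A := B ^ ((2 - p) / 2) with hAdef
  have hQ : ∑ x, (∑ i ∈ Finset.range K ×ˢ Finset.range (K + 1), QQ ι K i.1 i.2 f x) ^ p ≤
      Z ^ p * (C * A * T) := by
    refine sumLp p (by linarith) _ (fun i : ℕ × ℕ => QQ ι K i.1 i.2 f)
      (fun i x => QQ_nonneg ι K i.1 i.2 f x) (fun i : ℕ × ℕ => w1 ^ i.1 * w2 ^ i.2)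
      (fun i => by positivity) _ Z (by positivity) ?_ ?_
    · intro i _
      refine (H G d ι K B hB hV i.1 i.2 f hf).trans (le_of_eq ?_)
      have y1 : ∀ (b : ℝ) (n : ℕ), 0 ≤ b → (b ^ n) ^ p = (b ^ p) ^ n := by
        intro b n hb
        rw [← Real.rpow_natCast, ← Real.rpow_natCast, ← Real.rpow_mul hb, ← Real.rpow_mul hb, mul_comm]
      rw [Real.mul_rpow (by positivity) (by positivity), y1 _ _ a1.le, y1 _ _ a2.le, e1, e2]
      ring
    · have g : ∀ (w : ℝ) (n : ℕ), 0 < w → w < 1 → ∑ i ∈ Finset.range n, w ^ i ≤ (1 - w)⁻¹ := by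
        intro w n h0 h1
        rw [← tsum_geometric_of_lt_one h0.le h1]
        exact Summable.sum_le_tsum _ (fun i _ => by positivity) (summable_geometric_of_lt_one h0.le h1)
      rw [Finset.sum_product]
      simp only [← Finset.mul_sum, ← Finset.sum_mul]
      rw [hZ]
      refine mul_le_mul (g _ _ a1 b1) (g _ _ a2 b2) (Finset.sum_nonneg fun i _ => by positivity) ?_
      exact inv_nonneg.2 (by linarith)
  calc ∑ x, MX ι K f x ^ p ≤ ∑ x, 2 ^ (p - 1) * (m x ^ p + 2 ^ p *
        (∑ i ∈ Finset.range K ×ˢ Finset.range (K + 1), QQ ι K i.1 i.2 f x) ^ p) := by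
        refine Finset.sum_le_sum fun x _ => ?_
        have hs : 0 ≤ ∑ i ∈ Finset.range K ×ˢ Finset.range (K + 1), QQ ι K i.1 i.2 f x :=
          Finset.sum_nonneg fun _ _ => QQ_nonneg _ _ _ _ _ _
        refine (Real.rpow_le_rpow (MX_nonneg ι K f hf x) (MX_le ι K f hf m hm x) hp0.le).trans ?_
        refine (add_rpow_two (hm0 x) (by positivity) (by linarith)).trans
          (le_of_eq ?_)
        rw [Real.mul_rpow (by norm_num) hs]
    _ = 2 ^ (p - 1) * (∑ x, m x ^ p + 2 ^ p *
        ∑ x, (∑ i ∈ Finset.range K ×ˢ Finset.range (K + 1), QQ ι K i.1 i.2 f x) ^ p) := by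
        rw [← Finset.mul_sum, Finset.sum_add_distrib, ← Finset.mul_sum]
    _ ≤ 2 ^ (p - 1) * ((p / (p - 1)) ^ p * (A * T) + 2 ^ p * (Z ^ p * (C * A * T))) := by
        have : T ≤ A * T := le_mul_of_one_le_left hT hBa
        have := mul_le_mul_of_nonneg_left this hA.le
        gcongr
        exact hms.trans this
    _ = _ := by ring

lemma Val_mono {G : Type} [Fintype G] [AddCommGroup G] {d : ℕ} (ι : (Fin d → ℤ) →+ G) {p : ℝ} {K : ℕ}
    {B B' : ℝ} (h : Val ι p K B) (hB : B ≤ B') : Val ι p K B' := fun f hf =>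
  (h f hf).trans (mul_le_mul_of_nonneg_right hB (Finset.sum_nonneg fun x _ => Real.rpow_nonneg (hf x) _))

lemma boot2 (p : ℝ) (hp : 3 / 2 < p) (hp2 : p < 2) :
    ∃ C : ℝ, 0 < C ∧
      ∀ (G : Type) [Fintype G] [AddCommGroup G] (d : ℕ) (ι : (Fin d → ℤ) →+ G) (K : ℕ), Val ι p K C := by
  obtain ⟨C, hC, H⟩ := boot1 p hp hp2
  obtain ⟨α, hα⟩ : ∃ α, α = (2 - p) / 2 := ⟨_, rfl⟩
  rw [← hα] at H
  have hα0 : 0 < α := by rw [hα]; linarith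
  have hα1 : α < 1 := by rw [hα]; linarith
  refine ⟨max 2 ((2 * C) ^ (1 / (1 - α))), by positivity, ?_⟩
  intro G _ _ d ι K
  let S : Set ℝ := {B | 1 ≤ B ∧ Val ι p K B}
  have hne : S.Nonempty := ⟨max 1 _, le_max_left _ _,
    Val_mono ι (Val_apriori ι p (by linarith) K) (le_max_right _ _)⟩
  have hbd : BddBelow S := ⟨1, fun B hB => hB.1⟩
  have hs1 : 1 ≤ sInf S := le_csInf hne fun B hB => hB.1
  obtain ⟨B, ⟨hB1, hBV⟩, hBlt⟩ := exists_lt_of_csInf_lt hne (show sInf S < 2 * sInf S by linarith)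
  have hmem : max 1 (C * B ^ α) ∈ S := ⟨le_max_left _ _, Val_mono ι (H G d ι K B hB1 hBV) (le_max_right _ _)⟩
  have hle := csInf_le hbd hmem
  have hB0 : 0 < B := by linarith
  refine Val_mono ι hBV ?_
  rcases le_total 1 (C * B ^ α) with h | h
  · rw [max_eq_right h] at hle
    refine le_trans ?_ (le_max_right _ _)
    have h3 : B ≤ 2 * C * B ^ α := by linarith
    have h4 : B ^ (1 - α) ≤ 2 * C := by
      rw [Real.rpow_sub hB0, Real.rpow_one, div_le_iff₀ (by positivity)]; exact h3
    calc B = (B ^ (1 - α)) ^ (1 / (1 - α)) := by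
          rw [← Real.rpow_mul hB0.le, mul_one_div_cancel (by linarith), Real.rpow_one]
      _ ≤ _ := Real.rpow_le_rpow (by positivity) h4 (one_div_nonneg.2 (by linarith))
  · rw [max_eq_left h] at hle
    refine le_trans ?_ (le_max_left _ _)
    linarith


noncomputable def av (d N : ℕ) (F : (Fin d → ℤ) → ℝ) (x : Fin d → ℤ) : ℝ :=
  (∑ y ∈ box d N, F (x - y)) / (box d N).card

lemma box_card_pos (d N : ℕ) : (0:ℝ) < (box d N).card := by
  have : (0 : Fin d → ℤ) ∈ box d N := by
    simp [box, Finset.mem_Icc, Pi.le_def]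
  exact_mod_cast Finset.card_pos.2 ⟨0, this⟩

lemma av_nonneg (d N : ℕ) (F : (Fin d → ℤ) → ℝ) (hF : ∀ x, 0 ≤ F x) (x) : 0 ≤ av d N F x :=
  div_nonneg (Finset.sum_nonneg fun _ _ => hF _) (box_card_pos d N).le

lemma av_rpow (d N : ℕ) (F : (Fin d → ℤ) → ℝ) (hF : ∀ x, 0 ≤ F x) (x) (u : ℝ) (hu : 1 ≤ u) :
    av d N F x ^ u ≤ av d N (fun z => F z ^ u) x := by
  have hc := box_card_pos d N
  have := Real.rpow_arith_mean_le_arith_mean_rpow (box d N) (fun _ => ((box d N).card : ℝ)⁻¹)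
    (fun y => F (x - y)) (fun _ _ => by positivity)
    (by rw [Finset.sum_const, nsmul_eq_mul]; exact mul_inv_cancel₀ hc.ne') (fun _ _ => hF _) hu
  unfold av
  rw [div_eq_inv_mul, div_eq_inv_mul, Finset.mul_sum, Finset.mul_sum]
  exact this

lemma lin1 (p : ℝ) (C : ℝ) (hC : 0 < C) (hp : 0 < p)
    (H : ∀ (G : Type) [Fintype G] [AddCommGroup G] (d : ℕ) (ι : (Fin d → ℤ) →+ G) (K : ℕ), Val ι p K C)
    (d : ℕ) (F : (Fin d → ℤ) → ℝ) (hF : ∀ x, 0 ≤ F x) (s : Finset (Fin d → ℤ)) (K : ℕ)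
    (N : (Fin d → ℤ) → ℕ) (hN : ∀ x, N x < 2 ^ K) :
    ∃ t : Finset (Fin d → ℤ), ∑ x ∈ s, av d (N x) F x ^ p ≤ C * ∑ z ∈ t, F z ^ p := by
  classical
  obtain ⟨R, hR⟩ : ∃ R : ℕ, ∀ x ∈ s, ∀ i, |x i| ≤ R := by
    refine ⟨∑ x ∈ s, ∑ i, (x i).natAbs, fun x hx i => ?_⟩
    have h1 : (x i).natAbs ≤ ∑ i, (x i).natAbs :=
      Finset.single_le_sum (f := fun i => (x i).natAbs) (fun _ _ => Nat.zero_le _) (Finset.mem_univ i)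
    have h2 : ∑ i, (x i).natAbs ≤ ∑ x ∈ s, ∑ i, (x i).natAbs :=
      Finset.single_le_sum (f := fun x : Fin d → ℤ => ∑ i, (x i).natAbs) (fun _ _ => Nat.zero_le _) hx
    rw [Int.abs_eq_natAbs]
    exact_mod_cast h1.trans h2
  obtain ⟨M, hM⟩ : ∃ M, M = 2 * (R + 2 ^ K) + 1 := ⟨_, rfl⟩
  have : NeZero M := ⟨by omega⟩
  let G := Fin d → ZMod M
  let ι : (Fin d → ℤ) →+ G := (Int.castAddHom (ZMod M)).compLeft (Fin d)
  let rep : G → (Fin d → ℤ) := fun z i => (z i).valMinAbs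
  have hrep : Function.Injective rep := by
    intro z w h
    funext i
    exact ZMod.injective_valMinAbs (congrFun h i)
  have hri : ∀ x : Fin d → ℤ, (∀ i, |x i| ≤ R + 2 ^ K) → rep (ι x) = x := by
    intro x hx
    funext i
    refine (ZMod.valMinAbs_spec _ _).2 ⟨rfl, ?_⟩
    have := abs_le.1 (hx i)
    rw [Set.mem_Ioc, hM]
    push_cast
    constructor <;> linarith
  have hav : ∀ x ∈ s, av d (N x) F x = cv (kA ι (N x)) (fun z => F (rep z)) (ι x) := by
    intro x hx
    unfold kA av
    rw [cv_ker]
    congr 1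
    refine Finset.sum_congr rfl fun y hy => ?_
    rw [← map_sub, hri]
    intro i
    have h1 := abs_le.1 (hR x hx i)
    have h2 := Finset.mem_Icc.1 hy
    have h3 := h2.1 i
    have h4 := h2.2 i
    have h5 : ((N x : ℕ) : ℤ) < 2 ^ K := by exact_mod_cast hN x
    simp only at h3 h4
    rw [Pi.sub_apply, abs_le]
    constructor <;> linarith
  refine ⟨Finset.univ.image rep, ?_⟩
  have hm0 := MX_nonneg ι K (fun z => F (rep z)) (fun z => hF _)
  calc ∑ x ∈ s, av d (N x) F x ^ p ≤ ∑ x ∈ s, MX ι K (fun z => F (rep z)) (ι x) ^ p := by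
        refine Finset.sum_le_sum fun x hx => ?_
        refine Real.rpow_le_rpow (av_nonneg _ _ _ hF _) ?_ hp.le
        rw [hav x hx]
        exact kA_le_MX ι K _ (hN x) _ _
    _ = ∑ z ∈ s.image ι, MX ι K (fun z => F (rep z)) z ^ p := by
        rw [Finset.sum_image]
        intro x hx y hy h
        have hh : ∀ x ∈ s, rep (ι x) = x := fun x hx => hri x fun i => (hR x hx i).trans (by
          have : (0:ℤ) ≤ 2 ^ K := by positivity
          linarith)
        rw [← hh x hx, ← hh y hy, h]
    _ ≤ ∑ z, MX ι K (fun z => F (rep z)) z ^ p :=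
        Finset.sum_le_sum_of_subset_of_nonneg (Finset.subset_univ _) fun z _ _ =>
          Real.rpow_nonneg (hm0 z) _
    _ ≤ C * ∑ z, F (rep z) ^ p := H G d ι K _ fun z => hF _
    _ = _ := by rw [Finset.sum_image (fun x _ y _ h => hrep h)]

lemma lin2 (p : ℝ) (hp : 3 / 2 < p) : ∃ C : ℝ, 0 < C ∧ ∀ (d : ℕ) (F : (Fin d → ℤ) → ℝ) (_ : ∀ x, 0 ≤ F x)
    (s : Finset (Fin d → ℤ)) (K : ℕ) (N : (Fin d → ℤ) → ℕ) (_ : ∀ x, N x < 2 ^ K),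
    ∃ t : Finset (Fin d → ℤ), ∑ x ∈ s, av d (N x) F x ^ p ≤ C * ∑ z ∈ t, F z ^ p := by
  rcases lt_or_ge p 2 with h | h
  · obtain ⟨C, hC, H⟩ := boot2 p hp h
    exact ⟨C, hC, fun d F hF s K N hN => lin1 p C hC (by linarith) H d F hF s K N hN⟩
  · obtain ⟨C, hC, H⟩ := boot2 (7 / 4) (by norm_num) (by norm_num)
    refine ⟨C, hC, fun d F hF s K N hN => ?_⟩
    obtain ⟨t, ht⟩ := lin1 (7 / 4) C hC (by norm_num) H d (fun z => F z ^ (p / (7 / 4)))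
      (fun z => Real.rpow_nonneg (hF z) _) s K N hN
    refine ⟨t, ?_⟩
    have e : ∀ a : ℝ, 0 ≤ a → a ^ p = (a ^ (p / (7 / 4))) ^ (7 / 4 : ℝ) := fun a ha => by
      rw [← Real.rpow_mul ha]; congr 1; ring
    refine le_trans (Finset.sum_le_sum fun x _ => ?_) (ht.trans (le_of_eq ?_))
    · rw [e _ (av_nonneg _ _ _ hF _)]
      refine Real.rpow_le_rpow (Real.rpow_nonneg (av_nonneg _ _ _ hF _) _) ?_ (by norm_num)
      exact av_rpow d _ F hF x _ (by rw [le_div_iff₀ (by norm_num)]; linarith)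
    · congr 1
      exact Finset.sum_congr rfl fun z _ => (e _ (hF z)).symm

lemma cubeAvg_le (d : ℕ) (t : ℝ) (ht : 0 < t) (f : (Fin d → ℤ) → ℂ) (x : Fin d → ℤ) :
    ‖cubeAvg d t f x‖ ≤ av d ⌊t⌋.toNat (fun z => ‖f z‖) x := by
  have hN : ⌊t⌋ = ((⌊t⌋.toNat : ℕ) : ℤ) := (Int.toNat_of_nonneg (Int.floor_nonneg.2 ht.le)).symm
  generalize ⌊t⌋.toNat = N at hN
  unfold cubeAvg av
  rw [hN, norm_mul, div_eq_inv_mul]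
  have hc : (box d N).card = (2 * N + 1) ^ d := by
    unfold box
    rw [Pi.card_Icc]
    simp only [Int.card_Icc, Finset.prod_const, Finset.card_univ, Fintype.card_fin]
    congr 1
    omega
  have e : ‖((((2 * (N:ℤ) + 1) ^ d : ℤ) : ℂ))⁻¹‖ = ((box d N).card : ℝ)⁻¹ := by
    rw [norm_inv, hc]
    congr 1
    have : ((((2 * (N:ℤ) + 1) ^ d : ℤ) : ℂ)) = (((2 * N + 1) ^ d : ℕ) : ℂ) := by push_cast; rfl
    rw [this, Complex.norm_natCast]
  rw [e]
  exact mul_le_mul_of_nonneg_left (norm_sum_le _ _) (inv_nonneg.2 (Nat.cast_nonneg _))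

lemma fin_case (p : ℝ) (hp : 3 / 2 < p) : ∃ C : ℝ, 0 < C ∧ ∀ (d : ℕ) (f : (Fin d → ℤ) → ℂ),
    ∑' x, (⨆ t : {t : ℝ // 0 < t}, (‖cubeAvg d (↑t) f x‖₊ : ℝ≥0∞)) ^ p ≤
      ENNReal.ofReal C * ∑' x, nnC f x ^ p := by
  obtain ⟨C, hC, H⟩ := lin2 p hp
  have hp0 : 0 < p := by linarith
  refine ⟨C, hC, fun d f => ?_⟩
  obtain ⟨F, hFd⟩ : ∃ F : (Fin d → ℤ) → ℝ, F = fun z => ‖f z‖ := ⟨_, rfl⟩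
  have hF : ∀ z, 0 ≤ F z := fun z => by rw [hFd]; exact norm_nonneg _
  obtain ⟨g, hg⟩ : ∃ g : ℕ → (Fin d → ℤ) → ℝ≥0∞, g = fun K x => ⨆ N : Fin (2 ^ K), ENNReal.ofReal (av d N F x) :=
    ⟨_, rfl⟩
  have hgm : ∀ x, Monotone fun K => g K x := by
    intro x K L hKL
    simp only [hg]
    refine iSup_le fun N => ?_
    exact le_iSup (fun N : Fin (2 ^ L) => ENNReal.ofReal (av d N F x))
      ⟨N, N.2.trans_le (Nat.pow_le_pow_right (by norm_num) hKL)⟩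
  have h1 : ∀ x, (⨆ t : {t : ℝ // 0 < t}, (‖cubeAvg d (↑t) f x‖₊ : ℝ≥0∞)) ≤ ⨆ K, g K x := by
    intro x
    refine iSup_le fun t => ?_
    have hlt : ⌊(t:ℝ)⌋.toNat < 2 ^ ⌊(t:ℝ)⌋.toNat := Nat.lt_two_pow_self
    refine le_trans ?_ (le_iSup (fun K => g K x) ⌊(t:ℝ)⌋.toNat)
    simp only [hg]
    refine le_trans ?_ (le_iSup (fun N : Fin (2 ^ ⌊(t:ℝ)⌋.toNat) => ENNReal.ofReal (av d N F x)) ⟨_, hlt⟩)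
    rw [← enorm_eq_nnnorm, ← ofReal_norm]
    rw [hFd]
    exact ENNReal.ofReal_le_ofReal (cubeAvg_le d t t.2 f x)
  have hnn : ∀ z, nnC f z ^ p = ENNReal.ofReal (F z ^ p) := by
    intro z
    rw [← ENNReal.ofReal_rpow_of_nonneg (hF z) hp0.le, hFd]
    simp only [nnC]
    rw [← enorm_eq_nnnorm, ← ofReal_norm]
  have hK : ∀ (s : Finset (Fin d → ℤ)) (K : ℕ), ∑ x ∈ s, g K x ^ p ≤ ENNReal.ofReal C * ∑' x, nnC f x ^ p := by
    intro s K
    have : ∀ x, ∃ N : Fin (2 ^ K), g K x = ENNReal.ofReal (av d N F x) := by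
      intro x
      haveI : Nonempty (Fin (2 ^ K)) := ⟨⟨0, by positivity⟩⟩
      obtain ⟨N, hN⟩ := exists_eq_ciSup_of_finite (f := fun N : Fin (2 ^ K) => ENNReal.ofReal (av d N F x))
      exact ⟨N, by rw [hg]; exact hN.symm⟩
    choose N hN using this
    obtain ⟨t, ht⟩ := H d F hF s K (fun x => N x) (fun x => (N x).2)
    calc ∑ x ∈ s, g K x ^ p = ENNReal.ofReal (∑ x ∈ s, av d (N x) F x ^ p) := by
          rw [ENNReal.ofReal_sum_of_nonneg fun x _ => Real.rpow_nonneg (av_nonneg _ _ _ hF _) _]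
          refine Finset.sum_congr rfl fun x _ => ?_
          rw [hN, ENNReal.ofReal_rpow_of_nonneg (av_nonneg _ _ _ hF _) hp0.le]
      _ ≤ ENNReal.ofReal (C * ∑ z ∈ t, F z ^ p) := ENNReal.ofReal_le_ofReal ht
      _ = ENNReal.ofReal C * ∑ z ∈ t, nnC f z ^ p := by
          rw [ENNReal.ofReal_mul hC.le, ENNReal.ofReal_sum_of_nonneg fun x _ => Real.rpow_nonneg (hF _) _]
          simp only [hnn]
      _ ≤ _ := by
          gcongr
          exact ENNReal.sum_le_tsum t
  rw [ENNReal.tsum_eq_iSup_sum]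
  refine iSup_le fun s => ?_
  calc _ ≤ ∑ x ∈ s, ⨆ K, g K x ^ p := by
        refine Finset.sum_le_sum fun x _ => ?_
        refine (ENNReal.rpow_le_rpow (h1 x) hp0.le).trans (le_of_eq ?_)
        exact (ENNReal.orderIsoRpow p hp0).map_iSup _
    _ = ⨆ K, ∑ x ∈ s, g K x ^ p :=
        ENNReal.finsetSum_iSup_of_monotone fun x K L h => ENNReal.rpow_le_rpow (hgm x h) hp0.le
    _ ≤ _ := iSup_le fun K => hK s K

lemma inf_case (d : ℕ) (f : (Fin d → ℤ) → ℂ) (x : Fin d → ℤ) (t : ℝ) (ht : 0 < t) :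
    (‖cubeAvg d t f x‖₊ : ℝ≥0∞) ≤ ⨆ z, nnC f z := by
  by_cases h : (⨆ z, nnC f z) = ∞
  · rw [h]; exact le_top
  rw [← enorm_eq_nnnorm, ← ofReal_norm]
  refine ENNReal.ofReal_le_of_le_toReal ((cubeAvg_le d t ht f x).trans ?_)
  unfold av
  have hb : ∀ z, ‖f z‖ ≤ (⨆ z, nnC f z).toReal := by
    intro z
    have := ENNReal.toReal_mono h (le_iSup (nnC f) z)
    simpa [nnC] using this
  rw [div_le_iff₀ (box_card_pos _ _)]
  refine (Finset.sum_le_sum fun y _ => hb (x - y)).trans (le_of_eq ?_)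
  rw [Finset.sum_const, nsmul_eq_mul, mul_comm]

/-- dimension-free maximal inequality over cubes for `p ∈ (3/2, ∞]`
(Theorem 1.3). -/
theorem statement2 (p : ℝ≥0∞) (hp : 3 / 2 < p) :
    ∃ C : ℝ, 0 < C ∧ ∀ (d : ℕ) (f : (Fin d → ℤ) → ℂ),
      lpZ d p (nnC f) ≠ ∞ →
      lpZ d p (fun x => ⨆ t : {t : ℝ // 0 < t}, (‖cubeAvg d (↑t) f x‖₊ : ℝ≥0∞))
        ≤ ENNReal.ofReal C * lpZ d p (nnC f) := by
  by_cases hpt : p = ∞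
  · refine ⟨1, one_pos, fun d f _ => ?_⟩
    simp only [lpZ, hpt, if_true, ENNReal.ofReal_one, one_mul]
    exact iSup_le fun x => iSup_le fun t => inf_case d f x t t.2
  · have hp' : (3 / 2 : ℝ) < p.toReal := by
      have := (ENNReal.toReal_lt_toReal (ne_top_of_lt hp) hpt).2 hp
      rwa [ENNReal.toReal_div, ENNReal.toReal_ofNat, ENNReal.toReal_ofNat] at this
    obtain ⟨C, hC, H⟩ := fin_case p.toReal hp'
    have hp0 : 0 < 1 / p.toReal := one_div_pos.2 (by linarith)
    refine ⟨C ^ (1 / p.toReal), Real.rpow_pos_of_pos hC _, fun d f _ => ?_⟩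
    simp only [lpZ, hpt, if_false]
    rw [← ENNReal.ofReal_rpow_of_nonneg hC.le hp0.le, ← ENNReal.mul_rpow_of_nonneg _ _ hp0.le]
    exact ENNReal.rpow_le_rpow (H d f) hp0.le
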